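/- Let (s_{0,0}, …, s_{0,m}) = N(σ_0, …, σ_m) be a Nikishin system, and for each n ∈ ℤ₊ consider the multi-index n = (n, n+1, …, n+1) ∈ ℤ₊^{m+1}, a type II polynomial Q_n with associated polynomials P_{n,k}, the simple zeros x_{n,1}, …, x_{n,|n|} of Q_n (all lying in the interior of Co(supp σ_0)), and λ_{n,k,i} := P_{n,k}(x_{n,i})/Q_n'(x_{n,i}). Then for each k = 0, …, m and every continuous function f on Co(supp σ_0): lim_{n→∞} Σ_{i=1}^{|n|} λ_{n,k,i}·f(x_{n,i}) = ∫ f(x) ds_{0,k}(x). (The paper states this more generally for every bounded Riemann–Stieltjes integrable function f on Co(supp σ_0).) -/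

import Mathlib

open MeasureTheory Set Polynomial Filter

noncomputable section

/-- A signed Borel measure on `ℝ`, represented by a pair of (nonnegative) measures
(a "positive part" and a "negative part"). -/
structure SignedM where
  pos : MeasureTheory.Measure ℝ
  neg : MeasureTheory.Measure ℝ

namespace SignedM

/-- Integral of a complex-valued function against a signed measure. -/
def cintegral (s : SignedM) (f : ℝ → ℂ) : ℂ :=
  (∫ x, f x ∂s.pos) - ∫ x, f x ∂s.neg

/-- Integral of a real-valued function against a signed measure. -/
def rintegral (s : SignedM) (f : ℝ → ℝ) : ℝ :=
  (∫ x, f x ∂s.pos) - ∫ x, f x ∂s.neg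

/-- The Cauchy transform `ŝ(z) = ∫ ds(x)/(z - x)` at a complex point. -/
def cauchy (s : SignedM) (z : ℂ) : ℂ :=
  s.cintegral fun x => (z - (x : ℂ))⁻¹

/-- The Cauchy transform at a real point (real-valued). -/
def cauchyR (s : SignedM) (x : ℝ) : ℝ :=
  s.rintegral fun t => (x - t)⁻¹

/-- The total variation `|s|` (for the constant-sign representation used here). -/
def mass (s : SignedM) : ℝ :=
  (s.pos Set.univ).toReal + (s.neg Set.univ).toReal

/-- The (topological) support of a nonnegative measure. -/
def msupport (μ : MeasureTheory.Measure ℝ) : Set ℝ :=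
  {x | ∀ U : Set ℝ, IsOpen U → x ∈ U → μ U ≠ 0}

/-- The support of a signed measure. -/
def supp (s : SignedM) : Set ℝ := msupport s.pos ∪ msupport s.neg

/-- The signed measure `g·s` with (real, possibly sign-changing) density `g` w.r.t. `s`. -/
def withDensityR (s : SignedM) (g : ℝ → ℝ) : SignedM where
  pos := s.pos.withDensity (fun x => ENNReal.ofReal (g x)) +
    s.neg.withDensity (fun x => ENNReal.ofReal (-g x))
  neg := s.pos.withDensity (fun x => ENNReal.ofReal (-g x)) +
    s.neg.withDensity (fun x => ENNReal.ofReal (g x))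

/-- The product `⟨a, b⟩`: the measure with density `b̂` with respect to `a`. -/
def nik (a b : SignedM) : SignedM := a.withDensityR b.cauchyR

end SignedM

/-- `s ∈ M(Δ)`: a finite Borel measure with constant sign, whose support is compact and
consists of infinitely many points, `Δ` being the smallest closed interval containing it. -/
structure IsM (s : SignedM) (Δ : Set ℝ) : Prop where
  posFinite : MeasureTheory.IsFiniteMeasure s.pos
  negFinite : MeasureTheory.IsFiniteMeasure s.neg
  constSign : s.pos = 0 ∨ s.neg = 0
  compactSupp : IsCompact s.supp
  infiniteSupp : s.supp.Infinite
  hullEq : Δ = Set.Icc (sInf s.supp) (sSup s.supp)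

/-- A set of reals, viewed inside `ℂ`. -/
def cSet (Δ : Set ℝ) : Set ℂ := (fun x : ℝ => (x : ℂ)) '' Δ

/-- `τ` is the inverse measure of `s`: `1/ŝ(z) = z/|s| + b + τ̂(z)` on `ℂ ∖ Δ`. -/
def IsInverse (s τ : SignedM) (Δ : Set ℝ) : Prop :=
  ∃ b : ℝ, ∀ z : ℂ, z ∉ cSet Δ →
    (s.cauchy z)⁻¹ = z / (s.mass : ℂ) + (b : ℂ) + τ.cauchy z

/-- The iterated products `s_{j,k} = ⟨σ_j, σ_{j+1}, …, σ_k⟩` of a Nikishin system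
(`s_{j,k} = σ_j` when `j ≥ k`). -/
def nikSys (σ : ℕ → SignedM) : ℕ → ℕ → SignedM
  | j, k => if h : j < k then (σ j).nik (nikSys σ (j + 1) k) else σ j
  termination_by j k => k - j
  decreasing_by omega

/-- `Q` is a type II polynomial for the Nikishin system `N(σ₀, …, σ_m)` and the
multi-index `n`, with associated polynomials `P k`:  `Q ≠ 0`, `deg Q ≤ |n|` and
`Q·ŝ_{0,k} − P_k = O(1/z^{n_k+1})` as `z → ∞` for every `k ≤ m`. -/
def IsTypeII (σ : ℕ → SignedM) (m : ℕ) (n : ℕ → ℕ) (Q : Polynomial ℝ)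
    (P : ℕ → Polynomial ℝ) : Prop :=
  Q ≠ 0 ∧ Q.degree ≤ ((∑ j ∈ Finset.range (m + 1), n j : ℕ) : WithBot ℕ) ∧
  ∀ k ≤ m, ∃ C R : ℝ, ∀ z : ℂ, R ≤ ‖z‖ →
    ‖aeval z Q * (nikSys σ 0 k).cauchy z - aeval z (P k)‖ ≤ C / ‖z‖ ^ (n k + 1)

/-- A finite measure carried by the interval `[a, b]` but not by any finite set. -/
structure CarriedBy (μ : Measure ℝ) (a b : ℝ) : Prop where
  finite : IsFiniteMeasure μ
  compl_null : μ (Icc a b)ᶜ = 0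
  compl_finite_ne : ∀ F : Set ℝ, F.Finite → μ Fᶜ ≠ 0

/-- The Cauchy transform of the measure `g dμ` at a real point. -/
def realCauchy (μ : Measure ℝ) (g : ℝ → ℝ) (x : ℝ) : ℝ := ∫ t, (x - t)⁻¹ * g t ∂μ

namespace CarriedBy

variable {μ ν : Measure ℝ} {a b c d : ℝ} {f g : ℝ → ℝ}

lemma ae_mem (h : CarriedBy μ a b) : ∀ᵐ x ∂μ, x ∈ Icc a b := by
  rw [ae_iff]; exact h.compl_null

lemma restrict_eq (h : CarriedBy μ a b) : μ.restrict (Icc a b) = μ :=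
  Measure.restrict_eq_self_of_ae_mem h.ae_mem

lemma le (h : CarriedBy μ a b) : a ≤ b := by
  by_contra hab
  have := h.compl_null
  rw [Icc_eq_empty hab] at this
  exact h.compl_finite_ne ∅ finite_empty this

lemma integrable (h : CarriedBy μ a b) (hf : ContinuousOn f (Icc a b)) : Integrable f μ := by
  have := h.finite
  rw [← h.restrict_eq]
  exact hf.integrableOn_Icc

lemma integral_congr (h : CarriedBy μ a b) (hfg : ∀ x ∈ Icc a b, f x = g x) :
    ∫ x, f x ∂μ = ∫ x, g x ∂μ :=
  integral_congr_ae (h.ae_mem.mono hfg)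

lemma continuousOn_kernel {x : ℝ} (hx : x ∉ Icc a b) (hg : ContinuousOn g (Icc a b)) :
    ContinuousOn (fun t => (x - t)⁻¹ * g t) (Icc a b) := by
  refine ContinuousOn.mul (ContinuousOn.inv₀ (by fun_prop) ?_) hg
  intro t ht h0
  exact hx (by rwa [sub_eq_zero.1 h0])

lemma integrable_kernel (h : CarriedBy μ a b) {x : ℝ} (hx : x ∉ Icc a b)
    (hg : ContinuousOn g (Icc a b)) : Integrable (fun t => (x - t)⁻¹ * g t) μ :=
  h.integrable (continuousOn_kernel hx hg)

lemma integrable_prod (h : CarriedBy μ a b) (h' : CarriedBy ν c d) {K : ℝ → ℝ → ℝ}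
    (hK : ContinuousOn (Function.uncurry K) (Icc a b ×ˢ Icc c d)) :
    Integrable (Function.uncurry K) (μ.prod ν) := by
  have := h.finite
  have := h'.finite
  rw [← h.restrict_eq, ← h'.restrict_eq, Measure.prod_restrict]
  exact hK.integrableOn_compact (isCompact_Icc.prod isCompact_Icc)

lemma integral_swap (h : CarriedBy μ a b) (h' : CarriedBy ν c d) {K : ℝ → ℝ → ℝ}
    (hK : ContinuousOn (Function.uncurry K) (Icc a b ×ˢ Icc c d)) :
    ∫ x, ∫ y, K x y ∂ν ∂μ = ∫ y, ∫ x, K x y ∂μ ∂ν := by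
  have := h.finite
  have := h'.finite
  exact integral_integral_swap (h.integrable_prod h' hK)

lemma continuousOn_realCauchy (h : CarriedBy μ a b) (hg : ContinuousOn g (Icc a b)) :
    ContinuousOn (realCauchy μ g) (Icc a b)ᶜ := by
  have := h.finite
  intro x₀ hx₀
  apply ContinuousAt.continuousWithinAt
  obtain ⟨δ, hδ, hball⟩ := Metric.isOpen_iff.1 isClosed_Icc.isOpen_compl x₀ hx₀
  have hev : ∀ᶠ x in nhds x₀, x ∈ Metric.ball x₀ (δ / 2) := Metric.ball_mem_nhds _ (by positivity)
  have hmem : ∀ x ∈ Metric.ball x₀ (δ / 2), x ∉ Icc a b := fun x hx =>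
    hball (Metric.ball_subset_ball (by linarith) hx)
  refine continuousAt_of_dominated (bound := fun t => (δ / 2)⁻¹ * |g t|) ?_ ?_ ?_ ?_
  · filter_upwards [hev] with x hx
    exact (h.integrable_kernel (hmem x hx) hg).aestronglyMeasurable
  · filter_upwards [hev] with x hx
    filter_upwards [h.ae_mem] with t ht
    rw [Real.norm_eq_abs, abs_mul, abs_inv]
    have h1 : δ ≤ |t - x₀| := by
      by_contra hlt
      exact hball (show t ∈ Metric.ball x₀ δ by rw [Metric.mem_ball, Real.dist_eq]; linarith) ht
    have h2 : |x - x₀| < δ / 2 := by rwa [Metric.mem_ball, Real.dist_eq] at hx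
    have h3 : |t - x₀| ≤ |x - t| + |x - x₀| := by
      have := abs_sub_le t x x₀
      rwa [abs_sub_comm t x] at this
    gcongr
    linarith
  · exact (h.integrable hg).abs.const_mul _
  · filter_upwards [h.ae_mem] with t ht
    have : x₀ - t ≠ 0 := fun h0 => hx₀ (by rwa [sub_eq_zero.1 h0])
    fun_prop (disch := assumption)

lemma continuousOn_realCauchy' (h : CarriedBy μ a b) (hg : ContinuousOn g (Icc a b))
    (hd : Disjoint (Icc c d) (Icc a b)) : ContinuousOn (realCauchy μ g) (Icc c d) :=
  (h.continuousOn_realCauchy hg).mono hd.subset_compl_right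

/-- Fubini's theorem for the Cauchy kernel. -/
lemma integral_mul_realCauchy (h : CarriedBy μ a b) (h' : CarriedBy ν c d)
    (hf : ContinuousOn f (Icc a b)) (hg : ContinuousOn g (Icc c d))
    (hd : Disjoint (Icc a b) (Icc c d)) :
    ∫ x, f x * realCauchy ν g x ∂μ = -∫ t, g t * realCauchy μ f t ∂ν := by
  have hK : ContinuousOn (Function.uncurry fun x t => f x * ((x - t)⁻¹ * g t))
      (Icc a b ×ˢ Icc c d) := by
    refine ContinuousOn.mul (hf.comp continuousOn_fst fun p hp => hp.1) (ContinuousOn.mul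
      (ContinuousOn.inv₀ (by fun_prop) ?_) (hg.comp continuousOn_snd fun p hp => hp.2))
    intro p hp h0
    exact (Set.disjoint_left.1 hd hp.1) (by rw [sub_eq_zero.1 h0]; exact hp.2)
  have := h.integral_swap h' hK
  simp only [realCauchy, ← integral_const_mul, ← integral_neg]
  rw [this]
  congr 1; ext t; congr 1; ext x
  rw [← neg_sub t x, inv_neg]; ring

end CarriedBy

/-- A continuous function with finitely many zeros on an interval has the sign of a polynomial
whose degree is at most the number of zeros. -/
lemma exists_polynomial_same_sign (Z : Finset ℝ) : ∀ (S : Set ℝ) (Φ : ℝ → ℝ), S.OrdConnected →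
    ContinuousOn Φ S → (∀ x ∈ S, Φ x = 0 ↔ x ∈ Z) →
    ∃ p : ℝ[X], p.natDegree ≤ Z.card ∧ (∀ x, p.eval x = 0 → x ∈ Z) ∧
      ∀ x ∈ S, 0 ≤ p.eval x * Φ x := by
  have key : ∀ (S : Set ℝ) (Φ : ℝ → ℝ), S.OrdConnected → ContinuousOn Φ S →
      (∀ x ∈ S, Φ x ≠ 0) → (∀ x ∈ S, 0 ≤ Φ x) ∨ (∀ x ∈ S, Φ x ≤ 0) := by
    intro S Φ hS hΦ h0
    by_contra hcon
    push Not at hcon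
    obtain ⟨⟨x, hx, hx0⟩, y, hy, hy0⟩ := hcon
    obtain ⟨z, hz, hz0⟩ := hS.isPreconnected.intermediate_value hx hy hΦ ⟨hx0.le, hy0.le⟩
    exact h0 z hz hz0
  induction Z using Finset.induction_on_max with
  | empty =>
    intro S Φ hS hΦ hz
    rcases key S Φ hS hΦ (fun x hx h => by simpa using (hz x hx).1 h) with h | h
    · exact ⟨1, by simp, by simp, by simpa using h⟩
    · exact ⟨-1, by simp, by simp, by simpa using h⟩
  | insert z Z hmax ih =>
    intro S Φ hS hΦ hz
    have hzZ : z ∉ Z := fun h => lt_irrefl _ (hmax z h)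
    obtain ⟨p, hp1, hp2, hp3⟩ := ih (S ∩ Iio z) Φ (hS.inter ordConnected_Iio)
      (hΦ.mono inter_subset_left) (by
        intro x hx
        rw [hz x hx.1, Finset.mem_insert]
        exact or_iff_right (ne_of_lt hx.2))
    have hright := key (S ∩ Ioi z) (fun x => p.eval x * Φ x) (hS.inter ordConnected_Ioi)
      (p.continuous.continuousOn.mul (hΦ.mono inter_subset_left)) (by
        intro x hx h0
        have hxz : z < x := hx.2
        rcases mul_eq_zero.1 h0 with h | h
        · exact absurd (hmax x (hp2 x h)) (by simpa using hxz.le)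
        · rcases Finset.mem_insert.1 ((hz x hx.1).1 h) with h | h
          · exact hxz.ne' h
          · exact absurd (hmax x h) (by simpa using hxz.le))
    have hcard : (insert z Z).card = Z.card + 1 := Finset.card_insert_of_notMem hzZ
    have hΦz : z ∈ S → Φ z = 0 := fun hzS => (hz z hzS).2 (Finset.mem_insert_self _ _)
    rcases hright with h | h
    · refine ⟨p, by omega, fun x hx => Finset.mem_insert_of_mem (hp2 x hx), fun x hx => ?_⟩
      rcases lt_trichotomy x z with hlt | rfl | hlt
      · exact hp3 x ⟨hx, hlt⟩
      · simp [hΦz hx]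
      · exact h x ⟨hx, hlt⟩
    · refine ⟨p * (C z - X), ?_, ?_, fun x hx => ?_⟩
      · have h1 : (C z - X : ℝ[X]).natDegree ≤ 1 := by
          compute_degree
        exact natDegree_mul_le.trans (by omega)
      · intro x hx
        simp only [eval_mul, eval_sub, eval_C, eval_X, mul_eq_zero, sub_eq_zero] at hx
        rcases hx with hx | hx
        · exact Finset.mem_insert_of_mem (hp2 x hx)
        · simp [hx]
      · have e : (p * (C z - X)).eval x * Φ x = (z - x) * (p.eval x * Φ x) := by
          simp; ring
        rw [e]
        rcases lt_trichotomy x z with hlt | rfl | hlt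
        · exact mul_nonneg (by linarith) (hp3 x ⟨hx, hlt⟩)
        · simp
        · exact mul_nonneg_of_nonpos_of_nonpos (by linarith) (h x ⟨hx, hlt⟩)

/-- A continuous function orthogonal to all polynomials of degree less than `M` has at least `M`
zeros on the interval carrying the measure. -/
lemma CarriedBy.exists_zeros {μ : Measure ℝ} {a b : ℝ} (h : CarriedBy μ a b) {Φ : ℝ → ℝ}
    (hΦ : ContinuousOn Φ (Icc a b)) (M : ℕ)
    (horth : ∀ p : ℝ[X], p.degree < (M : ℕ) → ∫ x, p.eval x * Φ x ∂μ = 0) :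
    ∃ Z : Finset ℝ, Z.card = M ∧ ∀ z ∈ Z, z ∈ Icc a b ∧ Φ z = 0 := by
  by_cases hfin : {x | x ∈ Icc a b ∧ Φ x = 0}.Finite
  swap
  · obtain ⟨Z, hZ, hc⟩ := Set.Infinite.exists_subset_card_eq hfin M
    exact ⟨Z, hc, fun z hz => hZ hz⟩
  by_cases hcard : M ≤ hfin.toFinset.card
  · obtain ⟨Z, hZ, hc⟩ := Finset.exists_subset_card_eq hcard
    exact ⟨Z, hc, fun z hz => by simpa using hZ hz⟩
  exfalso
  obtain ⟨p, hp1, hp2, hp3⟩ := exists_polynomial_same_sign hfin.toFinset (Icc a b) Φ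
    ordConnected_Icc hΦ (by intro x hx; simp only [Finite.mem_toFinset, mem_ofPred_eq, hx, true_and])
  have hdeg : p.degree < (M : ℕ) := lt_of_le_of_lt degree_le_natDegree (by
    exact_mod_cast lt_of_le_of_lt hp1 (not_le.1 hcard))
  have hint : Integrable (fun x => p.eval x * Φ x) μ :=
    h.integrable (p.continuous.continuousOn.mul hΦ)
  have h0 := (integral_eq_zero_iff_of_nonneg_ae (h.ae_mem.mono hp3) hint).1 (horth p hdeg)
  refine h.compl_finite_ne _ hfin ?_
  have : ∀ᵐ x ∂μ, x ∈ {x | x ∈ Icc a b ∧ Φ x = 0} := by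
    filter_upwards [h0, h.ae_mem] with x hx hxm
    rcases mul_eq_zero.1 hx with hx | hx
    · simpa using hp2 x hx
    · exact ⟨hxm, hx⟩
  exact this

lemma degree_divByMonic_X_sub_C_lt {p : ℝ[X]} {n : ℕ} (hp : p.degree < (n + 1 : ℕ)) (t : ℝ) :
    (p /ₘ (X - C t)).degree < (n : ℕ) := by
  by_cases hq : p /ₘ (X - C t) = 0
  · rw [hq, degree_zero]; exact WithBot.bot_lt_coe _
  have hp0 : p ≠ 0 := by rintro rfl; simp at hq
  have h1 : p.natDegree < n + 1 := (natDegree_lt_iff_degree_lt hp0).2 hp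
  refine (natDegree_lt_iff_degree_lt hq).1 ?_
  rw [natDegree_divByMonic _ (monic_X_sub_C t), natDegree_X_sub_C]
  have h2 : p.natDegree ≠ 0 := by
    intro h0
    apply hq
    rw [divByMonic_eq_zero_iff (monic_X_sub_C t), degree_X_sub_C]
    exact lt_of_le_of_lt degree_le_natDegree (by rw [h0]; exact_mod_cast Nat.zero_lt_one)
  omega

lemma eval_eq_add_mul_divByMonic (p : ℝ[X]) (t x : ℝ) :
    p.eval x = p.eval t + (x - t) * (p /ₘ (X - C t)).eval x := by
  have h := congrArg (eval x) (modByMonic_add_div p (X - C t))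
  rw [modByMonic_X_sub_C_eq_C_eval] at h
  simpa using h.symm

/-- Orthogonality after division by a polynomial that vanishes at zeros of the function of the
second kind. -/
lemma CarriedBy.orth_div {μ : Measure ℝ} {a b : ℝ} (h : CarriedBy μ a b) (Z : Finset ℝ) :
    ∀ (Φ : ℝ → ℝ) (n : ℕ), ContinuousOn Φ (Icc a b) →
    (∀ p : ℝ[X], p.degree < (n : ℕ) → ∫ x, p.eval x * Φ x ∂μ = 0) →
    (∀ z ∈ Z, z ∉ Icc a b ∧ realCauchy μ Φ z = 0) →
    ∀ p : ℝ[X], p.degree < (n + Z.card : ℕ) →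
      ∫ x, p.eval x * (Φ x / ∏ z ∈ Z, (x - z)) ∂μ = 0 := by
  classical
  induction Z using Finset.induction_on with
  | empty => intro Φ n _ horth _ p hp; simpa using horth p (by simpa using hp)
  | insert z Z hz ih =>
    intro Φ n hΦ horth hzero p hp
    obtain ⟨hzI, hz0⟩ := hzero z (Finset.mem_insert_self _ _)
    have hzΦ : ∫ x, Φ x / (x - z) ∂μ = 0 := by
      rw [← neg_eq_zero, ← hz0, realCauchy, ← integral_neg]
      congr 1; ext x
      rw [← neg_sub z x, div_neg, neg_neg, div_eq_inv_mul]
    have hΦ' : ContinuousOn (fun x => Φ x / (x - z)) (Icc a b) := by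
      refine hΦ.div (by fun_prop) ?_
      intro x hx h0
      exact hzI (by rwa [← sub_eq_zero.1 h0])
    have main := ih (fun x => Φ x / (x - z)) (n + 1) hΦ' ?_ ?_ p (by
      rw [Finset.card_insert_of_notMem hz] at hp
      convert hp using 2
      ring)
    · rw [← main]
      congr 1; ext x
      rw [Finset.prod_insert hz, div_div]
    · intro q hq
      have e : ∀ x ∈ Icc a b, q.eval x * (Φ x / (x - z)) =
          q.eval z * (Φ x / (x - z)) + (q /ₘ (X - C z)).eval x * Φ x := by
        intro x hx
        have hxz : x - z ≠ 0 := fun h0 => hzI (by rwa [← sub_eq_zero.1 h0])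
        rw [eval_eq_add_mul_divByMonic q z x]
        field_simp
      have hI : Integrable (fun x => (q /ₘ (X - C z)).eval x * Φ x) μ :=
        h.integrable ((q /ₘ (X - C z)).continuous.continuousOn.mul hΦ)
      rw [h.integral_congr e, integral_add ((h.integrable hΦ').const_mul _) hI, integral_const_mul, hzΦ,
        horth _ (degree_divByMonic_X_sub_C_lt hq z)]
      simp
    · intro z' hz'
      obtain ⟨hzI', hz0'⟩ := hzero z' (Finset.mem_insert_of_mem hz')
      refine ⟨hzI', ?_⟩
      have hne : z' - z ≠ 0 := fun h0 => hz (by rwa [← sub_eq_zero.1 h0])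
      have e : ∀ x ∈ Icc a b, (z' - x)⁻¹ * (Φ x / (x - z)) =
          (z' - z)⁻¹ * ((z' - x)⁻¹ * Φ x) + (z' - z)⁻¹ * (Φ x / (x - z)) := by
        intro x hx
        have hxz : x - z ≠ 0 := fun h0 => hzI (by rwa [← sub_eq_zero.1 h0])
        have hxz' : z' - x ≠ 0 := fun h0 => hzI' (by rwa [sub_eq_zero.1 h0])
        field_simp
        ring
      have hz0'' : ∫ x, (z' - x)⁻¹ * Φ x ∂μ = 0 := hz0'
      rw [realCauchy, h.integral_congr e, integral_add ((h.integrable_kernel hzI' hΦ).const_mul _)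
        ((h.integrable hΦ').const_mul _), integral_const_mul, integral_const_mul, hzΦ, hz0'']
      simp

/-- Orthogonality relations for the function of the second kind. -/
lemma CarriedBy.orth_realCauchy {μ ν : Measure ℝ} {a b c d : ℝ} (h : CarriedBy μ a b)
    (h' : CarriedBy ν c d) (hd : Disjoint (Icc a b) (Icc c d)) {Φ g : ℝ → ℝ}
    (hΦ : ContinuousOn Φ (Icc a b)) (hg : ContinuousOn g (Icc c d)) {n : ℕ}
    (h0 : ∀ p : ℝ[X], p.degree < (n : ℕ) → ∫ x, p.eval x * Φ x ∂μ = 0)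
    (h1 : ∀ p : ℝ[X], p.degree < (n + 1 : ℕ) → ∫ x, p.eval x * Φ x * realCauchy ν g x ∂μ = 0)
    (p : ℝ[X]) (hp : p.degree < (n + 1 : ℕ)) :
    ∫ t, p.eval t * realCauchy μ Φ t * g t ∂ν = 0 := by
  have hpΦ : ContinuousOn (fun x => p.eval x * Φ x) (Icc a b) := p.continuous.continuousOn.mul hΦ
  have e : ∀ t ∈ Icc c d, p.eval t * realCauchy μ Φ t * g t =
      g t * realCauchy μ (fun x => p.eval x * Φ x) t := by
    intro t ht
    have htI : t ∉ Icc a b := Set.disjoint_right.1 hd ht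
    have e2 : p.eval t * realCauchy μ Φ t = realCauchy μ (fun x => p.eval x * Φ x) t := by
      have e3 : ∀ x ∈ Icc a b, (t - x)⁻¹ * (p.eval x * Φ x) =
          p.eval t * ((t - x)⁻¹ * Φ x) - (p /ₘ (X - C t)).eval x * Φ x := by
        intro x hx
        have hxt : t - x ≠ 0 := fun h0 => htI (by rwa [sub_eq_zero.1 h0])
        rw [eval_eq_add_mul_divByMonic p t x]
        field_simp
        ring
      have hI : Integrable (fun x => (p /ₘ (X - C t)).eval x * Φ x) μ :=
        h.integrable ((p /ₘ (X - C t)).continuous.continuousOn.mul hΦ)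
      rw [realCauchy, realCauchy, h.integral_congr e3,
        integral_sub ((h.integrable_kernel htI hΦ).const_mul _) hI,
        h0 _ (degree_divByMonic_X_sub_C_lt hp t), integral_const_mul, sub_zero]
    rw [e2, mul_comm]
  rw [h'.integral_congr e, h'.integral_mul_realCauchy h hg hpΦ hd.symm, h1 p hp, neg_zero]

/-- The functions `⟨σ_{l+1}, …, σ_{l+d}⟩^` on the real line, with the convention that they are `1`
for `d = 0`. -/
def nikFun (μ : ℕ → Measure ℝ) : ℕ → ℕ → ℝ → ℝ
  | _, 0 => fun _ => 1
  | l, d + 1 => realCauchy (μ (l + 1)) (nikFun μ (l + 1) d)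

/-- The measures `μ_0, …, μ_m` generate a Nikishin system on the intervals `[a_j, b_j]`. -/
structure IsNikishin (m : ℕ) (μ : ℕ → Measure ℝ) (a b : ℕ → ℝ) : Prop where
  carried : ∀ j ≤ m, CarriedBy (μ j) (a j) (b j)
  disj : ∀ j, j + 1 ≤ m → Disjoint (Icc (a j) (b j)) (Icc (a (j + 1)) (b (j + 1)))

lemma nikFun_shift (μ : ℕ → Measure ℝ) (l d : ℕ) :
    nikFun (fun j => μ (j + 1)) l d = nikFun μ (l + 1) d := by
  induction d generalizing l with
  | zero => rfl
  | succ d ih => simp only [nikFun, ih]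

namespace IsNikishin

variable {m : ℕ} {μ : ℕ → Measure ℝ} {a b : ℕ → ℝ}

lemma shift (h : IsNikishin (m + 1) μ a b) :
    IsNikishin m (fun j => μ (j + 1)) (fun j => a (j + 1)) (fun j => b (j + 1)) :=
  ⟨fun j hj => h.carried (j + 1) (by omega), fun j hj => h.disj (j + 1) (by omega)⟩

lemma continuousOn_nikFun (h : IsNikishin m μ a b) (l d : ℕ) (hld : l + d ≤ m) :
    ContinuousOn (nikFun μ l d) (Icc (a l) (b l)) := by
  induction d generalizing l with
  | zero => exact continuousOn_const
  | succ d ih =>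
    exact (h.carried (l + 1) (by omega)).continuousOn_realCauchy' (ih (l + 1) (by omega))
      (h.disj l (by omega))

/-- A function orthogonal to a Nikishin system has many zeros. -/
lemma exists_zeros : ∀ (m : ℕ) (μ : ℕ → Measure ℝ) (a b : ℕ → ℝ), IsNikishin m μ a b →
    ∀ (Φ : ℝ → ℝ) (n : ℕ), ContinuousOn Φ (Icc (a 0) (b 0)) →
    (∀ j ≤ m, ∀ p : ℝ[X], p.degree < (n + 1 : ℕ) →
      ∫ x, p.eval x * Φ x * nikFun μ 0 j x ∂(μ 0) = 0) →
    ∃ Z : Finset ℝ, Z.card = (m + 1) * (n + 1) ∧ ∀ z ∈ Z, z ∈ Icc (a 0) (b 0) ∧ Φ z = 0 := by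
  intro m
  induction m with
  | zero =>
    intro μ a b h Φ n hΦ horth
    refine (h.carried 0 le_rfl).exists_zeros hΦ _ fun p hp => ?_
    simpa [nikFun] using horth 0 le_rfl p (by simpa using hp)
  | succ m ih =>
    intro μ a b h Φ n hΦ horth
    have h0 : ∀ p : ℝ[X], p.degree < (n + 1 : ℕ) → ∫ x, p.eval x * Φ x ∂(μ 0) = 0 := by
      intro p hp
      simpa [nikFun] using horth 0 (Nat.zero_le _) p hp
    have c0 := h.carried 0 (by omega)
    have c1 := h.carried 1 (by omega)
    have hd := h.disj 0 (by omega)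
    obtain ⟨Z, hZc, hZ⟩ := ih _ _ _ h.shift (realCauchy (μ 0) Φ) n
      (c0.continuousOn_realCauchy' hΦ hd.symm) (by
        intro j hj p hp
        rw [nikFun_shift]
        exact c0.orth_realCauchy c1 hd hΦ (h.continuousOn_nikFun 1 j (by omega))
          (fun p hp => h0 p (hp.trans (by exact_mod_cast Nat.lt_succ_self n)))
          (fun p hp => horth (j + 1) (by omega) p hp) p hp)
    have hout : ∀ z ∈ Z, z ∉ Icc (a 0) (b 0) := fun z hz => Set.disjoint_right.1 hd (hZ z hz).1
    have hne : ∀ x ∈ Icc (a 0) (b 0), ∏ z ∈ Z, (x - z) ≠ 0 := fun x hx =>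
      Finset.prod_ne_zero_iff.2 fun z hz h0 => hout z hz (by rwa [← sub_eq_zero.1 h0])
    obtain ⟨Z', hc', hZ'⟩ := c0.exists_zeros (Φ := fun x => Φ x / ∏ z ∈ Z, (x - z))
      (hΦ.div (by fun_prop) hne) (n + 1 + Z.card)
      (c0.orth_div Z Φ (n + 1) hΦ h0 (fun z hz => ⟨hout z hz, (hZ z hz).2⟩))
    refine ⟨Z', by rw [hc', hZc]; ring, fun z hz => ⟨(hZ' z hz).1, ?_⟩⟩
    have := (hZ' z hz).2
    exact (div_eq_zero_iff.1 this).resolve_right (hne z (hZ' z hz).1)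

end IsNikishin

/-- The quadrature coefficients with nodes `S` of the measure `⟨σ_0, …, σ_k⟩`. -/
def quadWeight (μ : ℕ → Measure ℝ) (S : Finset ℝ) (k : ℕ) (i : ℝ) : ℝ :=
  ∫ t, (Lagrange.basis S id i).eval t * nikFun μ 0 k t ∂(μ 0)

/-- The nodes `S` are the zeros of a type II polynomial for the multi-index
`(n, n + 1, …, n + 1)`. -/
structure IsNodes (m : ℕ) (μ : ℕ → Measure ℝ) (a b : ℕ → ℝ) (n : ℕ) (S : Finset ℝ) : Prop where
  mem : ∀ i ∈ S, i ∈ Icc (a 0) (b 0)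
  card : S.card = n + m * (n + 1)
  orth : ∀ j ≤ m, ∀ p : ℝ[X], p.degree < (if j = 0 then n else n + 1 : ℕ) →
    ∫ t, p.eval t * (Lagrange.nodal S id).eval t * nikFun μ 0 j t ∂(μ 0) = 0

namespace IsNodes

variable {m n : ℕ} {μ : ℕ → Measure ℝ} {a b : ℕ → ℝ} {S : Finset ℝ}

lemma orth_zero (hS : IsNodes m μ a b n S) (p : ℝ[X]) (hp : p.degree < (n : ℕ)) :
    ∫ t, p.eval t * (Lagrange.nodal S id).eval t ∂(μ 0) = 0 := by
  simpa [nikFun] using hS.orth 0 (Nat.zero_le _) p (by simpa using hp)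

/-- The nodal polynomial satisfies full orthogonality relations with respect to a varying
measure. -/
lemma exists_orth (h : IsNikishin m μ a b) (hS : IsNodes m μ a b n S) :
    ∃ Z : Finset ℝ, Z.card = m * (n + 1) ∧ (∀ z ∈ Z, z ∉ Icc (a 0) (b 0)) ∧
      ∀ p : ℝ[X], p.degree < (n + Z.card : ℕ) →
        ∫ t, p.eval t * ((Lagrange.nodal S id).eval t / ∏ z ∈ Z, (t - z)) ∂(μ 0) = 0 := by
  cases m with
  | zero =>
    exact ⟨∅, by simp, by simp, fun p hp => by simpa using hS.orth_zero p (by simpa using hp)⟩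
  | succ m =>
    have c0 := h.carried 0 (by omega)
    have c1 := h.carried 1 (by omega)
    have hd := h.disj 0 (by omega)
    have hω : ContinuousOn (fun t => (Lagrange.nodal S id).eval t) (Icc (a 0) (b 0)) :=
      (Lagrange.nodal S id).continuous.continuousOn
    obtain ⟨Z, hZc, hZ⟩ := IsNikishin.exists_zeros _ _ _ _ h.shift (realCauchy (μ 0) _) n
      (c0.continuousOn_realCauchy' hω hd.symm) (by
        intro j hj p hp
        rw [nikFun_shift]
        exact c0.orth_realCauchy c1 hd hω (h.continuousOn_nikFun 1 j (by omega))
          hS.orth_zero (fun p hp => hS.orth (j + 1) (by omega) p (by simpa using hp)) p hp)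
    have hout : ∀ z ∈ Z, z ∉ Icc (a 0) (b 0) := fun z hz => Set.disjoint_right.1 hd (hZ z hz).1
    exact ⟨Z, hZc, hout, c0.orth_div Z _ n hω hS.orth_zero fun z hz => ⟨hout z hz, (hZ z hz).2⟩⟩

lemma mul_eval_basis {i : ℝ} (hi : i ∈ S) (x : ℝ) :
    (x - i) * (Lagrange.basis S id i).eval x =
      Lagrange.nodalWeight S id i * (Lagrange.nodal S id).eval x := by
  by_cases hx : x = i
  · subst hx
    have : (Lagrange.nodal S id).eval x = 0 := Lagrange.eval_nodal_at_node (v := id) hi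
    simp [this]
  · rw [Lagrange.eval_basis_not_at_node hi hx]
    have : x - i ≠ 0 := sub_ne_zero.2 hx
    simp only [id]
    field_simp

lemma quadWeight_zero_nonneg (h : IsNikishin m μ a b) (hS : IsNodes m μ a b n S) {i : ℝ}
    (hi : i ∈ S) : 0 ≤ quadWeight μ S 0 i := by
  obtain ⟨Z, hZc, hout, horth⟩ := hS.exists_orth h
  have c0 := h.carried 0 (by omega)
  set L := Lagrange.basis S id i with hL
  set W : ℝ[X] := ∏ z ∈ Z, (X - C z) with hW
  have hWe : ∀ x, W.eval x = ∏ z ∈ Z, (x - z) := fun x => by simp [hW, eval_prod]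
  have hWne : ∀ x ∈ Icc (a 0) (b 0), W.eval x ≠ 0 := fun x hx => by
    rw [hWe]
    exact Finset.prod_ne_zero_iff.2 fun z hz h0 => hout z hz (by rwa [← sub_eq_zero.1 h0])
  set G : ℝ[X] := W - C (W.eval i) * L with hG
  have hN : S.card = n + Z.card := by rw [hS.card, hZc]
  have hpos : 0 < S.card := Finset.card_pos.2 ⟨i, hi⟩
  have hLi : L.eval i = 1 := Lagrange.eval_basis_self (v := id) Function.injective_id.injOn hi
  have hGi : G.eval i = 0 := by simp [hG, hLi]
  have hLd : L.degree < (S.card + 1 : ℕ) := by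
    rw [hL, Lagrange.degree_basis Function.injective_id.injOn hi]
    exact_mod_cast by omega
  have hWd : W.degree < (S.card + 1 : ℕ) := by
    rw [hW, degree_prod]
    simp only [degree_X_sub_C, Finset.sum_const, nsmul_eq_mul, mul_one]
    exact_mod_cast by omega
  have hGd : G.degree < (S.card + 1 : ℕ) := by
    refine (degree_sub_le _ _).trans_lt (max_lt hWd ?_)
    exact ((degree_mul_le _ _).trans (add_le_add degree_C_le le_rfl)).trans_lt (by rwa [zero_add])
  have e : ∀ x ∈ Icc (a 0) (b 0), L.eval x * nikFun μ 0 0 x = L.eval x ^ 2 * W.eval i / W.eval x +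
      Lagrange.nodalWeight S id i * ((G /ₘ (X - C i)).eval x *
        ((Lagrange.nodal S id).eval x / ∏ z ∈ Z, (x - z))) := by
    intro x hx
    have h1 := eval_eq_add_mul_divByMonic G i x
    have h2 := mul_eval_basis hi x
    have h3 := hWne x hx
    have h4 : G.eval x = W.eval x - W.eval i * L.eval x := by simp [hG]
    rw [hGi, zero_add, h4] at h1
    rw [← hWe, nikFun]
    field_simp
    linear_combination L.eval x * h1 + (G /ₘ (X - C i)).eval x * h2
  have i1 : ContinuousOn (fun x => L.eval x ^ 2 * W.eval i / W.eval x) (Icc (a 0) (b 0)) :=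
    ContinuousOn.div (by fun_prop) (by fun_prop) hWne
  have i2 : ContinuousOn (fun x => (G /ₘ (X - C i)).eval x *
        ((Lagrange.nodal S id).eval x / ∏ z ∈ Z, (x - z))) (Icc (a 0) (b 0)) := by
    refine ContinuousOn.mul (by fun_prop) (ContinuousOn.div (by fun_prop) (by fun_prop) ?_)
    intro x hx; rw [← hWe]; exact hWne x hx
  rw [quadWeight, c0.integral_congr e, integral_add (c0.integrable i1)
    ((c0.integrable i2).const_mul _), integral_const_mul, horth, mul_zero, add_zero]
  · refine integral_nonneg_of_ae (c0.ae_mem.mono fun x hx => ?_)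
    have hii := hS.mem i hi
    have hs : 0 ≤ W.eval i * W.eval x := by
      rw [hWe, hWe, ← Finset.prod_mul_distrib]
      refine Finset.prod_nonneg fun z hz => ?_
      have := hout z hz
      simp only [mem_Icc, not_and_or, not_le] at this hx hii
      rcases this with h | h
      · exact mul_nonneg (by linarith) (by linarith)
      · exact mul_nonneg_of_nonpos_of_nonpos (by linarith) (by linarith)
    have : L.eval x ^ 2 * W.eval i / W.eval x =
        L.eval x ^ 2 * (W.eval i * W.eval x) / W.eval x ^ 2 := by
      have h3 := hWne x hx
      field_simp
    show 0 ≤ L.eval x ^ 2 * W.eval i / W.eval x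
    rw [this]
    positivity
  · rw [← hN]
    exact degree_divByMonic_X_sub_C_lt hGd i

lemma sum_abs_quadWeight_zero_le (h : IsNikishin m μ a b) (hS : IsNodes m μ a b n S) :
    ∑ i ∈ S, |quadWeight μ S 0 i| ≤ (μ 0).real univ := by
  have c0 := h.carried 0 (by omega)
  rw [Finset.sum_congr rfl fun i hi => abs_of_nonneg (hS.quadWeight_zero_nonneg h hi)]
  rcases S.eq_empty_or_nonempty with rfl | hne
  · simp
  simp only [quadWeight]
  rw [← integral_finsetSum]
  · simp only [nikFun, mul_one, ← eval_finsetSum]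
    rw [Lagrange.sum_basis Function.injective_id.injOn hne]
    simp
  · intro i _
    exact c0.integrable (ContinuousOn.mul (by fun_prop) (h.continuousOn_nikFun 0 0 (by omega)))

end IsNodes

open scoped InnerProductSpace CompactlySupported in
/-- The spectral measure of a self-adjoint operator at a vector. -/
lemma exists_spectral_measure {H : Type*} [NormedAddCommGroup H] [InnerProductSpace ℂ H]
    [CompleteSpace H] (A : H →L[ℂ] H) (hA : IsSelfAdjoint A) (v : H) :
    ∃ τ : Measure ℝ, IsFiniteMeasure τ ∧ τ (spectrum ℝ A)ᶜ = 0 ∧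
      ∀ f : ℝ → ℝ, ContinuousOn f (spectrum ℝ A) → ∫ x, f x ∂τ = (⟪v, cfc f A v⟫_ℂ).re := by
  have hcpt : CompactSpace (spectrum ℝ A) :=
    isCompact_iff_compactSpace.1 (ContinuousFunctionalCalculus.isCompact_spectrum A)
  let Λ : C_c(spectrum ℝ A, ℝ) →ₚ[ℝ] ℝ := PositiveLinearMap.mk₀
    { toFun := fun g => (⟪v, cfcHom hA (g : C(spectrum ℝ A, ℝ)) v⟫_ℂ).re
      map_add' := fun f g => by
        have : ((f + g : C_c(spectrum ℝ A, ℝ)) : C(spectrum ℝ A, ℝ)) = f + g := rfl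
        rw [this, map_add]
        simp
      map_smul' := fun r g => by
        have : ((r • g : C_c(spectrum ℝ A, ℝ)) : C(spectrum ℝ A, ℝ)) = r • (g : C(_, ℝ)) := rfl
        rw [this, map_smul]
        simp }
    (fun g hg => by
      have h1 : 0 ≤ cfcHom hA (g : C(spectrum ℝ A, ℝ)) := by
        rw [cfcHom_nonneg_iff]
        exact hg
      have h2 := ((ContinuousLinearMap.nonneg_iff_isPositive _).1 h1).re_inner_nonneg_right v
      exact h2)
  have hint : ∀ g : C(spectrum ℝ A, ℝ),
      ∫ x, g x ∂(RealRMK.rieszMeasure Λ) = (⟪v, cfcHom hA g v⟫_ℂ).re := fun g =>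
    RealRMK.integral_rieszMeasure Λ (CompactlySupportedContinuousMap.continuousMapEquiv g)
  have hfin : IsFiniteMeasure (RealRMK.rieszMeasure Λ) :=
    ⟨isCompact_univ.measure_lt_top⟩
  have hcl : IsClosed (spectrum ℝ A) := spectrum.isClosed A
  have hemb : MeasurableEmbedding (Subtype.val : spectrum ℝ A → ℝ) :=
    MeasurableEmbedding.subtype_coe hcl.measurableSet
  refine ⟨(RealRMK.rieszMeasure Λ).map Subtype.val, inferInstance, ?_, fun f hf => ?_⟩
  · rw [hemb.map_apply]
    simp
  · rw [hemb.integral_map, cfc_apply f A hA hf, ← hint]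
    rfl

open scoped InnerProductSpace in
/-- The real Stieltjes transform of the spectral measure through the resolvent. -/
lemma exists_resolvent_measure {H : Type*} [NormedAddCommGroup H] [InnerProductSpace ℂ H]
    [CompleteSpace H] (A : H →L[ℂ] H) (hA : IsSelfAdjoint A) (v : H) {lo hi : ℝ}
    (hlo : ∀ u : H, lo * ‖u‖ ^ 2 ≤ (⟪A u, u⟫_ℂ).re) (hhi : ∀ u : H, (⟪A u, u⟫_ℂ).re ≤ hi * ‖u‖ ^ 2) :
    ∃ τ : Measure ℝ, IsFiniteMeasure τ ∧ τ (Icc lo hi)ᶜ = 0 ∧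
      ∀ x u, x ∉ Icc lo hi → (x : ℂ) • u - A u = v →
        ∫ t, (x - t)⁻¹ ∂τ = (⟪v, u⟫_ℂ).re ∧
        ∀ s u', s ∉ Icc lo hi → (s : ℂ) • u' - A u' = v →
          ∫ t, (x - t)⁻¹ * (s - t)⁻¹ ∂τ = (⟪u, u'⟫_ℂ).re := by
  obtain ⟨τ, hτ1, hτ2, hτ3⟩ := exists_spectral_measure A hA v
  have hspec : spectrum ℝ A ⊆ Icc lo hi := by
    have h1 : ∀ r : ℝ, ∀ u : H, ((algebraMap ℝ (H →L[ℂ] H)) r) u = (r : ℂ) • u := by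
      intro r u
      rw [Algebra.algebraMap_eq_smul_one]
      simp
    have hsa : ∀ r : ℝ, IsSelfAdjoint ((algebraMap ℝ (H →L[ℂ] H)) r) := fun r =>
      IsSelfAdjoint.algebraMap _ (IsSelfAdjoint.all r)
    have h2 : ∀ (r : ℝ) (u : H), (⟪(r : ℂ) • u, u⟫_ℂ).re = r * ‖u‖ ^ 2 := by
      intro r u
      rw [inner_smul_left, inner_self_eq_norm_sq_to_K]
      simp [← Complex.ofReal_pow]
    have hA1 : algebraMap ℝ (H →L[ℂ] H) lo ≤ A := by
      rw [ContinuousLinearMap.le_def, ContinuousLinearMap.isPositive_def']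
      refine ⟨hA.sub (hsa lo), fun u => ?_⟩
      have := hlo u
      rw [ContinuousLinearMap.reApplyInnerSelf, _root_.sub_apply, inner_sub_left, h1,
        map_sub]
      simp only [RCLike.re_eq_complex_re, h2]
      linarith
    have hA2 : A ≤ algebraMap ℝ (H →L[ℂ] H) hi := by
      rw [ContinuousLinearMap.le_def, ContinuousLinearMap.isPositive_def']
      refine ⟨(hsa hi).sub hA, fun u => ?_⟩
      have := hhi u
      rw [ContinuousLinearMap.reApplyInnerSelf, _root_.sub_apply, inner_sub_left, h1,
        map_sub]
      simp only [RCLike.re_eq_complex_re, h2]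
      linarith
    intro r hr
    exact ⟨(algebraMap_le_iff_le_spectrum (a := A) hA).1 hA1 r hr,
      (le_algebraMap_iff_spectrum_le (a := A) hA).1 hA2 r hr⟩
  have hne : ∀ x, x ∉ Icc lo hi → ∀ t ∈ spectrum ℝ A, x - t ≠ 0 := by
    intro x hx t ht h0
    exact hx (by rw [sub_eq_zero.1 h0]; exact hspec ht)
  have hcont : ∀ x, x ∉ Icc lo hi → ContinuousOn (fun t => (x - t)⁻¹) (spectrum ℝ A) :=
    fun x hx => ContinuousOn.inv₀ (by fun_prop) (hne x hx)
  have hres : ∀ x, x ∉ Icc lo hi → ∀ u, (x : ℂ) • u - A u = v →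
      cfc (fun t => (x - t)⁻¹) A v = u := by
    intro x hx u hu
    have e1 : cfc (fun t => (x - t)⁻¹) A * cfc (fun t => x - t) A = 1 := by
      rw [← cfc_mul _ _ A (hcont x hx) (by fun_prop), ← cfc_one ℝ A]
      refine cfc_congr fun t ht => ?_
      simp [inv_mul_cancel₀ (hne x hx t ht)]
    have e2 : cfc (fun t => x - t) A = algebraMap ℝ (H →L[ℂ] H) x - A := by
      rw [cfc_sub (fun _ => x) (fun t => t) A, cfc_const x A, cfc_id' ℝ A]
    rw [e2] at e1
    have e3 := congrArg (fun B : H →L[ℂ] H => B u) e1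
    simp only [mul_apply_eq_comp] at e3
    rw [← hu]
    convert e3 using 2
    · simp [Algebra.algebraMap_eq_smul_one]
    · rfl
  refine ⟨τ, hτ1, measure_mono_null (compl_subset_compl.2 hspec) hτ2, fun x u hx hu => ⟨?_, ?_⟩⟩
  · rw [hτ3 _ (hcont x hx), hres x hx u hu]
  · intro s u' hs hu'
    rw [hτ3 (fun t => (x - t)⁻¹ * (s - t)⁻¹) ((hcont x hx).mul (hcont s hs)), cfc_mul _ _ A (hcont x hx) (hcont s hs),
      mul_apply_eq_comp, hres s hs u' hu', ← hres x hx u hu]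
    congr 1
    have : IsSelfAdjoint (cfc (fun t => (x - t)⁻¹) A) := cfc_predicate _ _
    exact (this.isSymmetric v u').symm

/-- Multiplying a Cauchy transform by a polynomial produces a polynomial and a Cauchy transform. -/
lemma exists_polynomial_dividedDifference {μ : Measure ℝ} {g : ℝ → ℝ}
    (hI : ∀ p : ℝ[X], Integrable (fun t => p.eval t * g t) μ) (q : ℝ[X]) :
    ∃ (D : ℝ[X]) (E : ℝ → ℝ[X]), ∀ x, q = C (q.eval x) + (X - C x) * E x ∧
      D.eval x = ∫ t, (E x).eval t * g t ∂μ := by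
  induction q using Polynomial.induction_on' with
  | add p q hp hq =>
    obtain ⟨D, E, h⟩ := hp
    obtain ⟨D', E', h'⟩ := hq
    refine ⟨D + D', fun x => E x + E' x, fun x => ⟨?_, ?_⟩⟩
    · have h1 := (h x).1
      have h2 := (h' x).1
      rw [eval_add, C_add]
      linear_combination h1 + h2
    · simp only [eval_add, add_mul]
      rw [integral_add (hI _) (hI _), (h x).2, (h' x).2]
  | monomial n r =>
    induction n with
    | zero => exact ⟨0, fun _ => 0, fun x => ⟨by simp, by simp⟩⟩
    | succ n ih =>
      obtain ⟨D, E, h⟩ := ih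
      refine ⟨X * D + C (∫ t, (monomial n r).eval t * g t ∂μ),
        fun x => C x * E x + monomial n r, fun x => ⟨?_, ?_⟩⟩
      · have h1 := (h x).1
        have h2 : (monomial (n + 1) r : ℝ[X]) = X * monomial n r := by
          rw [X_mul_monomial]
        rw [h2, eval_mul, eval_X, C_mul]
        linear_combination C x * h1
      · simp only [eval_add, eval_mul, eval_X, eval_C, add_mul, mul_assoc]
        rw [integral_add ((hI _).const_mul _) (hI _), integral_const_mul, (h x).2]

lemma mul_realCauchy_eq {μ : Measure ℝ} {g : ℝ → ℝ}
    (hI : ∀ p : ℝ[X], Integrable (fun t => p.eval t * g t) μ) {q E : ℝ[X]} {x : ℝ}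
    (hE : q = C (q.eval x) + (X - C x) * E) (hx : ∀ᵐ t ∂μ, t ≠ x)
    (hk : Integrable (fun t => (x - t)⁻¹ * g t) μ) :
    q.eval x * realCauchy μ g x =
      (∫ t, E.eval t * g t ∂μ) + realCauchy μ (fun t => q.eval t * g t) x := by
  have e : (fun t => (x - t)⁻¹ * (q.eval t * g t)) =ᵐ[μ]
      fun t => q.eval x * ((x - t)⁻¹ * g t) - E.eval t * g t := by
    filter_upwards [hx] with t ht
    have h1 := congrArg (eval t) hE
    simp only [eval_add, eval_mul, eval_sub, eval_X, eval_C] at h1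
    have h2 : x - t ≠ 0 := sub_ne_zero.2 ht.symm
    rw [h1]
    field_simp
    ring
  simp only [realCauchy]
  rw [integral_congr_ae e, integral_sub (hk.const_mul _) (hI E), integral_const_mul]
  ring

namespace CarriedBy

variable {μ : Measure ℝ} {a b : ℝ} {f g : ℝ → ℝ}

lemma integrable_polynomial_mul (h : CarriedBy μ a b) (hg : ContinuousOn g (Icc a b)) (p : ℝ[X]) :
    Integrable (fun t => p.eval t * g t) μ :=
  h.integrable (p.continuous.continuousOn.mul hg)

lemma ae_ne (h : CarriedBy μ a b) {x : ℝ} (hx : x ∉ Icc a b) : ∀ᵐ t ∂μ, t ≠ x :=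
  h.ae_mem.mono fun _ ht h0 => hx (h0 ▸ ht)

lemma tendsto_realCauchy (h : CarriedBy μ a b) (hg : ContinuousOn g (Icc a b)) :
    Tendsto (realCauchy μ g) atTop (nhds 0) := by
  have hb : ∀ᶠ x in atTop, ‖realCauchy μ g x‖ ≤ (x - b)⁻¹ * ∫ t, |g t| ∂μ := by
    filter_upwards [eventually_gt_atTop b] with x hx
    rw [realCauchy, ← integral_const_mul]
    refine norm_integral_le_of_norm_le ((h.integrable hg).abs.const_mul _)
      (h.ae_mem.mono fun t ht => ?_)
    have h1 : 0 < x - b := by linarith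
    have h2 : x - b ≤ x - t := by linarith [ht.2]
    rw [norm_mul, norm_inv, Real.norm_eq_abs, Real.norm_eq_abs, abs_of_pos (by linarith)]
    gcongr
  refine squeeze_zero_norm' hb ?_
  rw [← zero_mul (∫ t, |g t| ∂μ)]
  exact (tendsto_inv_atTop_zero.comp (tendsto_atTop_add_const_right _ (-b) tendsto_id)).mul_const _

/-- The order of vanishing at infinity of a Cauchy transform, up to a polynomial, controls the
moments. -/
lemma moments_eq_zero (h : CarriedBy μ a b) : ∀ (d : ℕ) (P : ℝ[X]) (g : ℝ → ℝ),
    ContinuousOn g (Icc a b) →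
    (∃ K : ℝ, ∀ᶠ x in atTop, |P.eval x + realCauchy μ g x| ≤ K / x ^ (d + 1)) →
    P = 0 ∧ ∀ ν < d, ∫ t, t ^ ν * g t ∂μ = 0 := by
  intro d
  have hP : ∀ (d : ℕ) (P : ℝ[X]) (g : ℝ → ℝ), ContinuousOn g (Icc a b) →
      (∃ K : ℝ, ∀ᶠ x in atTop, |P.eval x + realCauchy μ g x| ≤ K / x ^ (d + 1)) → P = 0 := by
    rintro d P g hg ⟨K, hK⟩
    have h1 : Tendsto (fun x => P.eval x + realCauchy μ g x) atTop (nhds 0) :=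
      squeeze_zero_norm' hK (tendsto_const_nhds.div_atTop (tendsto_pow_atTop (by omega)))
    have h2 : Tendsto (fun x => P.eval x) atTop (nhds 0) := by
      simpa using h1.sub (h.tendsto_realCauchy hg)
    exact (P.tendsto_nhds_iff.1 h2).1 |> fun h3 => leadingCoeff_eq_zero.1 h3
  induction d with
  | zero => exact fun P g hg hK => ⟨hP 0 P g hg hK, by simp⟩
  | succ d ih =>
    intro P g hg hK
    have hP0 := hP _ P g hg hK
    refine ⟨hP0, ?_⟩
    subst hP0
    obtain ⟨K, hK⟩ := hK
    have hXg : ContinuousOn (fun t => (X : ℝ[X]).eval t * g t) (Icc a b) :=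
      X.continuous.continuousOn.mul hg
    obtain ⟨h1, h2⟩ := ih (C (∫ t, g t ∂μ)) (fun t => (X : ℝ[X]).eval t * g t) hXg ⟨K, by
      filter_upwards [hK, eventually_gt_atTop b, eventually_gt_atTop 0] with x hx hxb hx0
      have hxI : x ∉ Icc a b := fun hx => not_lt.2 hx.2 hxb
      have e := mul_realCauchy_eq (h.integrable_polynomial_mul hg) (q := X) (E := 1) (x := x)
        (by simp) (h.ae_ne hxI) (h.integrable_kernel hxI hg)
      simp only [eval_X, eval_one, one_mul] at e
      simp only [eval_C, eval_X]
      rw [← e, abs_mul, abs_of_pos hx0]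
      simp only [eval_zero, zero_add] at hx
      calc x * |realCauchy μ g x| ≤ x * (K / x ^ (d + 1 + 1)) := by gcongr
        _ = K / x ^ (d + 1) := by field_simp; ring⟩
    intro ν hν
    cases ν with
    | zero => simpa using h1
    | succ ν =>
      rw [← h2 ν (by omega)]
      congr 1; ext t; simp; ring

lemma integral_polynomial_mul_eq_zero (h : CarriedBy μ a b) (hg : ContinuousOn g (Icc a b)) {d : ℕ}
    (h0 : ∀ ν < d, ∫ t, t ^ ν * g t ∂μ = 0) {p : ℝ[X]} (hp : p.degree < (d : ℕ)) :
    ∫ t, p.eval t * g t ∂μ = 0 := by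
  by_cases hp0 : p = 0
  · simp [hp0]
  have e : ∀ t, p.eval t * g t = ∑ i ∈ Finset.range d, p.coeff i * (t ^ i * g t) := by
    intro t
    rw [eval_eq_sum_range' ((natDegree_lt_iff_degree_lt hp0).2 hp), Finset.sum_mul]
    simp only [mul_assoc]
  simp only [e]
  rw [integral_finsetSum]
  · refine Finset.sum_eq_zero fun i hi => ?_
    rw [integral_const_mul, h0 i (Finset.mem_range.1 hi), mul_zero]
  · intro i _
    exact (h.integrable ((by fun_prop : ContinuousOn (fun t : ℝ => t ^ i) _).mul hg)).const_mul _

/-- A measure whose Cauchy transform is a Möbius transform of that of `μ` is not carried by a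
finite set. -/
lemma compl_finite_ne_of_realCauchy (h : CarriedBy μ a b) {τ : Measure ℝ} [IsFiniteMeasure τ]
    {lo hi ε : ℝ} (hbhi : b ≤ hi) (hτ : τ (Icc lo hi)ᶜ = 0)
    (hw : ∀ x, hi < x →
      (1 + ε * realCauchy μ (fun _ => 1) x) * realCauchy τ (fun _ => 1) x =
        realCauchy μ (fun _ => 1) x)
    (F : Set ℝ) (hF : F.Finite) : τ Fᶜ ≠ 0 := by
  intro hF0
  have hτae : ∀ᵐ t ∂τ, t ∈ Icc lo hi := by rw [ae_iff]; exact hτ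
  have hint : ∀ f : ℝ → ℝ, ContinuousOn f (Icc lo hi) → Integrable f τ := by
    intro f hf
    rw [← Measure.restrict_eq_self_of_ae_mem hτae]
    exact hf.integrableOn_Icc
  set p := Lagrange.nodal hF.toFinset id with hp
  have hp0 : ∀ᵐ t ∂τ, p.eval t = 0 := by
    have : ∀ᵐ t ∂τ, t ∈ F := by rw [ae_iff]; exact hF0
    filter_upwards [this] with t ht
    exact Lagrange.eval_nodal_at_node (v := id) (hF.mem_toFinset.2 ht)
  obtain ⟨D, E, hDE⟩ := exists_polynomial_dividedDifference (μ := τ) (g := fun _ => 1)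
    (fun p => hint _ (p.continuous.continuousOn.mul continuousOn_const)) p
  have h1 : ∀ x, hi < x → p.eval x * realCauchy τ (fun _ => 1) x = D.eval x := by
    intro x hx
    have hne : ∀ t ∈ Icc lo hi, x - t ≠ 0 := fun t ht h0 => by linarith [ht.2]
    rw [mul_realCauchy_eq (fun p => hint _ (p.continuous.continuousOn.mul continuousOn_const))
      (hDE x).1 (hτae.mono fun t ht => by linarith [ht.2])
      (hint _ ((ContinuousOn.inv₀ (by fun_prop) hne).mul continuousOn_const)), ← (hDE x).2,
      add_eq_left, realCauchy]
    exact integral_eq_zero_of_ae (hp0.mono fun t ht => by simp [ht])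
  set r := p - C ε * D with hr
  have hc : ContinuousOn (fun _ : ℝ => (1 : ℝ)) (Icc a b) := continuousOn_const
  have h2 : ∀ x, hi < x → r.eval x * realCauchy μ (fun _ => 1) x = D.eval x := by
    intro x hx
    have e1 := h1 x hx
    have e2 := hw x hx
    simp only [hr, eval_sub, eval_mul, eval_C]
    linear_combination (-p.eval x) * e2 + (1 + ε * realCauchy μ (fun _ => 1) x) * e1
  have hr0 : r ≠ 0 := by
    intro h0
    have hD : D = 0 := by
      refine eq_zero_of_infinite_isRoot D ((Ioi_infinite hi).mono fun x hx => ?_)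
      have := h2 x hx
      rw [h0] at this
      simpa using this.symm
    rw [hr, hD] at h0
    exact Lagrange.nodal_ne_zero (s := hF.toFinset) (v := (id : ℝ → ℝ)) (by simpa using h0)
  obtain ⟨D', E', hDE'⟩ := exists_polynomial_dividedDifference (h.integrable_polynomial_mul hc) r
  have hrc : ContinuousOn (fun t => r.eval t * 1) (Icc a b) := by fun_prop
  have h3 : ∀ᶠ x in atTop, (D' - D).eval x + realCauchy μ (fun t => r.eval t * 1) x = 0 := by
    filter_upwards [eventually_gt_atTop hi] with x hx
    have hxI : x ∉ Icc a b := fun h => by linarith [h.2]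
    have e := mul_realCauchy_eq (h.integrable_polynomial_mul hc) (hDE' x).1 (h.ae_ne hxI)
      (h.integrable_kernel hxI hc)
    rw [← (hDE' x).2, h2 x hx] at e
    rw [eval_sub]
    linarith
  obtain ⟨Z, hZc, hZ⟩ := h.exists_zeros (Φ := fun t => r.eval t * 1) hrc (r.natDegree + 1)
    (fun q hq => h.integral_polynomial_mul_eq_zero hrc
      (h.moments_eq_zero _ (D' - D) _ hrc ⟨0, h3.mono fun x hx => by simp only [hx]; simp⟩).2 hq)
  have hsub : Z.val ⊆ r.roots := by
    intro z hz
    rw [mem_roots hr0]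
    simpa using (hZ z hz).2
  have := card_le_degree_of_subset_roots hsub
  omega

end CarriedBy

namespace CarriedBy

variable {μ : Measure ℝ} {a b : ℝ} {f g : ℝ → ℝ}

lemma memLp (h : CarriedBy μ a b) (hf : ContinuousOn f (Icc a b)) (p : ENNReal) :
    MemLp (fun t => (f t : ℂ)) p μ := by
  have := h.finite
  obtain ⟨K, hK⟩ := isCompact_Icc.exists_bound_of_continuousOn hf
  refine MemLp.of_bound
    (Complex.continuous_ofReal.comp_aestronglyMeasurable (h.integrable hf).aestronglyMeasurable) K
    (h.ae_mem.mono fun t ht => ?_)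
  rw [Complex.norm_real]
  exact hK t ht

/-- A continuous function as an element of `L²`. -/
def toL2 (h : CarriedBy μ a b) (hf : ContinuousOn f (Icc a b)) : Lp ℂ 2 μ := (h.memLp hf 2).toLp

/-- Multiplication by the variable as an operator on `L²`. -/
def mulX (h : CarriedBy μ a b) : Lp ℂ 2 μ →L[ℂ] Lp ℂ 2 μ :=
  (ContinuousLinearMap.mul ℂ ℂ).holderL μ ⊤ 2 2 (h.memLp (f := id) continuousOn_id ⊤).toLp

lemma coeFn_toL2 (h : CarriedBy μ a b) (hf : ContinuousOn f (Icc a b)) :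
    h.toL2 hf =ᵐ[μ] fun t => (f t : ℂ) := MemLp.coeFn_toLp _

lemma coeFn_mulX (h : CarriedBy μ a b) (u : Lp ℂ 2 μ) :
    h.mulX u =ᵐ[μ] fun t => (t : ℂ) * u t := by
  have h1 := ContinuousLinearMap.coeFn_holder (r := 2) (ContinuousLinearMap.mul ℂ ℂ)
    (h.memLp (f := id) continuousOn_id ⊤).toLp u
  filter_upwards [h1, (h.memLp (f := id) continuousOn_id ⊤).coeFn_toLp] with t h2 h3
  refine h2.trans ?_
  rw [h3]
  rfl

open scoped InnerProductSpace in
lemma inner_toL2 (h : CarriedBy μ a b) (hf : ContinuousOn f (Icc a b))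
    (hg : ContinuousOn g (Icc a b)) :
    ⟪h.toL2 hf, h.toL2 hg⟫_ℂ = ((∫ t, f t * g t ∂μ : ℝ) : ℂ) := by
  rw [L2.inner_def, ← integral_complex_ofReal]
  refine integral_congr_ae ?_
  filter_upwards [h.coeFn_toL2 hf, h.coeFn_toL2 hg] with t h1 h2
  rw [h1, h2]
  simp [mul_comm]

open scoped InnerProductSpace in
lemma re_inner_nonneg_of_ae {u v : Lp ℂ 2 μ} {r : ℝ → ℝ} (hr : ∀ᵐ t ∂μ, 0 ≤ r t)
    (huv : v =ᵐ[μ] fun t => (r t : ℂ) * u t) : 0 ≤ (⟪v, u⟫_ℂ).re := by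
  have h1 := integral_re (L2.integrable_inner (𝕜 := ℂ) v u)
  rw [L2.inner_def]
  refine le_of_le_of_eq ?_ h1
  refine integral_nonneg_of_ae ?_
  filter_upwards [hr, huv] with t h2 h3
  rw [h3]
  simp only [RCLike.inner_apply, map_mul, Complex.conj_ofReal]
  have : u t * (r t * (starRingEnd ℂ) (u t)) = ((r t * Complex.normSq (u t) : ℝ) : ℂ) := by
    rw [Complex.ofReal_mul, Complex.normSq_eq_conj_mul_self]; ring
  rw [this]
  simpa using mul_nonneg h2 (Complex.normSq_nonneg _)

open scoped InnerProductSpace in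
lemma mulX_symm (h : CarriedBy μ a b) (u v : Lp ℂ 2 μ) : ⟪h.mulX u, v⟫_ℂ = ⟪u, h.mulX v⟫_ℂ := by
  rw [L2.inner_def, L2.inner_def]
  refine integral_congr_ae ?_
  filter_upwards [h.coeFn_mulX u, h.coeFn_mulX v] with t h1 h2
  rw [h1, h2]
  simp only [RCLike.inner_apply, map_mul, Complex.conj_ofReal]
  ring

lemma mulX_resolvent (h : CarriedBy μ a b) {x : ℝ} (hx : x ∉ Icc a b) :
    (x : ℂ) • h.toL2 (continuousOn_kernel hx continuousOn_const (g := fun _ => 1)) -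
      h.mulX (h.toL2 (continuousOn_kernel hx continuousOn_const (g := fun _ => 1))) =
      h.toL2 (f := fun _ => 1) continuousOn_const := by
  apply Lp.ext
  set G := h.toL2 (continuousOn_kernel hx continuousOn_const (g := fun _ => 1)) with hG
  have hGe : G =ᵐ[μ] fun t => (((x - t)⁻¹ * 1 : ℝ) : ℂ) := h.coeFn_toL2 _
  filter_upwards [Lp.coeFn_sub ((x : ℂ) • G) (h.mulX G), Lp.coeFn_smul (x : ℂ) G,
    h.coeFn_mulX G, hGe, h.ae_ne hx,
    h.coeFn_toL2 (f := fun _ => 1) continuousOn_const] with t h1 h2 h3 h4 h5 h6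
  rw [h1, Pi.sub_apply, h2, Pi.smul_apply, h3, h4, h6]
  have : (x : ℂ) - t ≠ 0 := by
    rw [← Complex.ofReal_sub, Complex.ofReal_ne_zero]
    exact sub_ne_zero.2 h5.symm
  push_cast
  rw [smul_eq_mul]
  field_simp

open scoped InnerProductSpace in
lemma mulX_bounds (h : CarriedBy μ a b) (u : Lp ℂ 2 μ) :
    a * ‖u‖ ^ 2 ≤ (⟪h.mulX u, u⟫_ℂ).re ∧ (⟪h.mulX u, u⟫_ℂ).re ≤ b * ‖u‖ ^ 2 := by
  have hs : ∀ r : ℝ, (⟪(r : ℂ) • u, u⟫_ℂ).re = r * ‖u‖ ^ 2 := by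
    intro r
    rw [inner_smul_left, inner_self_eq_norm_sq_to_K]
    simp [← Complex.ofReal_pow]
  have h1 := re_inner_nonneg_of_ae (u := u) (v := h.mulX u - (a : ℂ) • u) (r := fun t => t - a)
    (h.ae_mem.mono fun t ht => sub_nonneg.2 ht.1) (by
      filter_upwards [Lp.coeFn_sub (h.mulX u) ((a : ℂ) • u), Lp.coeFn_smul (a : ℂ) u,
        h.coeFn_mulX u] with t h1 h2 h3
      rw [h1, Pi.sub_apply, h2, h3, Pi.smul_apply, smul_eq_mul]
      push_cast; ring)
  have h2 := re_inner_nonneg_of_ae (u := u) (v := (b : ℂ) • u - h.mulX u) (r := fun t => b - t)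
    (h.ae_mem.mono fun t ht => sub_nonneg.2 ht.2) (by
      filter_upwards [Lp.coeFn_sub ((b : ℂ) • u) (h.mulX u), Lp.coeFn_smul (b : ℂ) u,
        h.coeFn_mulX u] with t h1 h2 h3
      rw [h1, Pi.sub_apply, h2, h3, Pi.smul_apply, smul_eq_mul]
      push_cast; ring)
  rw [inner_sub_left, Complex.sub_re, hs] at h1 h2
  exact ⟨by linarith, by linarith⟩

open scoped InnerProductSpace in
/-- Rank one perturbation of the multiplication operator. -/
lemma exists_perturbation (h : CarriedBy μ a b) {η : ℝ} (hη : 0 < η) :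
    ∃ (ε : ℝ) (τ : Measure ℝ), 0 < ε ∧ CarriedBy τ (a - η) (b + η) ∧
      ∀ x ∉ Icc (a - η) (b + η), 0 < 1 + ε * realCauchy μ (fun _ => 1) x ∧
        (1 + ε * realCauchy μ (fun _ => 1) x) * realCauchy τ (fun _ => 1) x =
          realCauchy μ (fun _ => 1) x ∧
        ∀ s ∉ Icc (a - η) (b + η),
          (1 + ε * realCauchy μ (fun _ => 1) x) * (1 + ε * realCauchy μ (fun _ => 1) s) *
            realCauchy τ (fun t => (s - t)⁻¹) x = realCauchy μ (fun t => (s - t)⁻¹) x := by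
  have := h.finite
  set M := μ.real univ with hM
  have hM0 : 0 ≤ M := measureReal_nonneg
  set ε := η / (2 * (M + 1)) with hε
  have hε0 : 0 < ε := by positivity
  have hεM : ε * M ≤ η / 2 := by
    rw [hε, div_mul_eq_mul_div, div_le_div_iff₀ (by positivity) (by positivity)]
    nlinarith
  have hc : ContinuousOn (fun _ : ℝ => (1 : ℝ)) (Icc a b) := continuousOn_const
  set v := h.toL2 hc with hv
  have hvv : ‖v‖ ^ 2 = M := by
    have h1 := inner_self_eq_norm_sq_to_K (𝕜 := ℂ) v
    rw [hv, h.inner_toL2 hc hc] at h1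
    have h2 : (∫ t, (1 : ℝ) * 1 ∂μ) = M := by simp [hM]
    rw [h2, ← hv] at h1
    exact Complex.ofReal_injective (by rw [h1]; simp)
  set A : Lp ℂ 2 μ →L[ℂ] Lp ℂ 2 μ := h.mulX - (ε : ℂ) • (innerSL ℂ v).smulRight v with hA
  have hAe : ∀ u, A u = h.mulX u - (ε : ℂ) • ⟪v, u⟫_ℂ • v := fun u => rfl
  have hAsym : IsSelfAdjoint A := by
    rw [ContinuousLinearMap.isSelfAdjoint_iff_isSymmetric]
    intro u w
    show ⟪A u, w⟫_ℂ = ⟪u, A w⟫_ℂ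
    rw [hAe, hAe, inner_sub_left, inner_sub_right, h.mulX_symm]
    simp only [inner_smul_left, inner_smul_right, inner_conj_symm, Complex.conj_ofReal]
    ring
  have hre : ∀ u, (⟪A u, u⟫_ℂ).re = (⟪h.mulX u, u⟫_ℂ).re - ε * ‖⟪v, u⟫_ℂ‖ ^ 2 := by
    intro u
    rw [hAe, inner_sub_left, Complex.sub_re]
    simp only [inner_smul_left, Complex.conj_ofReal]
    rw [← Complex.normSq_eq_norm_sq, mul_comm ((starRingEnd ℂ) _), Complex.mul_conj,
      ← Complex.ofReal_mul, Complex.ofReal_re]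
  obtain ⟨τ, hτ1, hτ2, hτ3⟩ := exists_resolvent_measure A hAsym v (lo := a - η) (hi := b + η)
    (fun u => by
      have h1 := (h.mulX_bounds u).1
      have h2 : ‖⟪v, u⟫_ℂ‖ ^ 2 ≤ M * ‖u‖ ^ 2 := by
        rw [← hvv, ← mul_pow]
        exact pow_le_pow_left₀ (norm_nonneg _) (norm_inner_le_norm v u) 2
      rw [hre]
      nlinarith [sq_nonneg ‖u‖])
    (fun u => by
      have h1 := (h.mulX_bounds u).2
      rw [hre]
      nlinarith [sq_nonneg ‖u‖, sq_nonneg ‖⟪v, u⟫_ℂ‖])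
  have hout : ∀ x ∉ Icc (a - η) (b + η), x ∉ Icc a b := fun x hx hx' =>
    hx ⟨by linarith [hx'.1], by linarith [hx'.2]⟩
  have hwpos : ∀ x ∉ Icc (a - η) (b + η), 0 < 1 + ε * realCauchy μ (fun _ => 1) x := by
    intro x hx
    have hb : |realCauchy μ (fun _ => 1) x| ≤ η⁻¹ * M := by
      rw [realCauchy, ← Real.norm_eq_abs, hM]
      refine norm_integral_le_of_norm_le_const (h.ae_mem.mono fun t ht => ?_)
      have hxt : η ≤ |x - t| := by
        rw [mem_Icc, not_and_or, not_le, not_le] at hx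
        rcases hx with hx | hx
        · rw [abs_of_neg (by linarith [ht.1])]; linarith [ht.1]
        · rw [abs_of_pos (by linarith [ht.2])]; linarith [ht.2]
      rw [mul_one, norm_inv, Real.norm_eq_abs]
      gcongr
    have h1 : ε * (η⁻¹ * M) ≤ 1 / 2 := by
      have : ε * (η⁻¹ * M) = η⁻¹ * (ε * M) := by ring
      rw [this]
      calc η⁻¹ * (ε * M) ≤ η⁻¹ * (η / 2) := by gcongr
        _ = 1 / 2 := by field_simp
    have h2 := mul_le_mul_of_nonneg_left hb hε0.le
    have h3 := mul_le_mul_of_nonneg_left (neg_abs_le (realCauchy μ (fun _ => 1) x)) hε0.le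
    linarith
  have key : ∀ x (hx : x ∉ Icc (a - η) (b + η)),
      ((x : ℂ) • (((1 + ε * realCauchy μ (fun _ => 1) x)⁻¹ : ℝ) : ℂ) •
        h.toL2 (continuousOn_kernel (hout x hx) hc)) -
      A ((((1 + ε * realCauchy μ (fun _ => 1) x)⁻¹ : ℝ) : ℂ) •
        h.toL2 (continuousOn_kernel (hout x hx) hc)) = v := by
    intro x hx
    have h1 := h.mulX_resolvent (hout x hx)
    have h2 := h.inner_toL2 hc (continuousOn_kernel (hout x hx) hc)
    simp only [one_mul] at h2
    have h3 : (∫ t, (x - t)⁻¹ * 1 ∂μ) = realCauchy μ (fun _ => 1) x := rfl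
    rw [h3] at h2
    set G := h.toL2 (continuousOn_kernel (hout x hx) hc)
    set w := 1 + ε * realCauchy μ (fun _ => 1) x with hw
    have hw0 : (w : ℂ) ≠ 0 := Complex.ofReal_ne_zero.2 (hwpos x hx).ne'
    rw [map_smul, smul_comm, ← smul_sub, Complex.ofReal_inv, inv_smul_eq_iff₀ hw0, hAe, h2,
      sub_sub_eq_add_sub, add_sub_right_comm, h1, hw]
    push_cast
    rw [add_smul, one_smul, mul_smul]
  have hres1 : ∀ x ∉ Icc (a - η) (b + η),
      (1 + ε * realCauchy μ (fun _ => 1) x) * realCauchy τ (fun _ => 1) x =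
          realCauchy μ (fun _ => 1) x := by
    intro x hx
    have h1 := (hτ3 x _ hx (key x hx)).1
    rw [inner_smul_right, h.inner_toL2 hc (continuousOn_kernel (hout x hx) hc), ← Complex.ofReal_mul,
      Complex.ofReal_re] at h1
    have h2 := (hwpos x hx).ne'
    simp only [realCauchy, mul_one, one_mul] at h1 h2 ⊢
    rw [h1, mul_inv_cancel_left₀ h2]
  refine ⟨ε, τ, hε0, ⟨hτ1, hτ2, ?_⟩, fun x hx => ⟨hwpos x hx, hres1 x hx, fun s hs => ?_⟩⟩
  · exact h.compl_finite_ne_of_realCauchy (by linarith) hτ2 fun x hx =>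
      hres1 x fun h => not_lt.2 h.2 hx
  · have h1 := (hτ3 x _ hx (key x hx)).2 s _ hs (key s hs)
    rw [inner_smul_right, inner_smul_left, h.inner_toL2 (continuousOn_kernel (hout x hx) hc)
      (continuousOn_kernel (hout s hs) hc), Complex.conj_ofReal, ← Complex.ofReal_mul,
      ← Complex.ofReal_mul, Complex.ofReal_re] at h1
    have h2 := (hwpos x hx).ne'
    have h3 := (hwpos s hs).ne'
    simp only [realCauchy, mul_one] at h1 h2 h3 ⊢
    rw [h1, mul_assoc, mul_inv_cancel_left₀ h3, mul_inv_cancel_left₀ h2]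

end CarriedBy

namespace CarriedBy

variable {μ : Measure ℝ} {a b : ℝ} {w : ℝ → ℝ}

lemma aemeasurable_ofReal (h : CarriedBy μ a b) (hw : ContinuousOn w (Icc a b)) :
    AEMeasurable (fun x => ENNReal.ofReal (w x)) μ :=
  (h.integrable hw).aemeasurable.ennreal_ofReal

lemma withDensity (h : CarriedBy μ a b) (hw : ContinuousOn w (Icc a b))
    (hw0 : ∀ x ∈ Icc a b, 0 < w x) :
    CarriedBy (μ.withDensity fun x => ENNReal.ofReal (w x)) a b where
  finite := isFiniteMeasure_withDensity_ofReal (h.integrable hw).2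
  compl_null := withDensity_absolutelyContinuous _ _ h.compl_null
  compl_finite_ne := by
    intro F hF h0
    rw [withDensity_apply_eq_zero' (h.aemeasurable_ofReal hw)] at h0
    refine h.compl_finite_ne F hF ?_
    refine le_antisymm ?_ zero_le
    calc μ Fᶜ ≤ μ (({x | ENNReal.ofReal (w x) ≠ 0} ∩ Fᶜ) ∪ (Icc a b)ᶜ) := by
          refine measure_mono fun x hx => ?_
          by_cases hxI : x ∈ Icc a b
          · exact Or.inl ⟨by simpa using hw0 x hxI, hx⟩
          · exact Or.inr hxI
      _ ≤ 0 + 0 := (measure_union_le _ _).trans (add_le_add h0.le h.compl_null.le)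
      _ = 0 := add_zero 0

lemma integral_withDensity (h : CarriedBy μ a b) (hw : ContinuousOn w (Icc a b))
    (hw0 : ∀ x ∈ Icc a b, 0 ≤ w x) (f : ℝ → ℝ) :
    ∫ x, f x ∂(μ.withDensity fun x => ENNReal.ofReal (w x)) = ∫ x, w x * f x ∂μ := by
  rw [integral_withDensity_eq_integral_toReal_smul₀ (h.aemeasurable_ofReal hw)
    (ae_of_all _ fun _ => ENNReal.ofReal_lt_top)]
  refine h.integral_congr fun x hx => ?_
  rw [ENNReal.toReal_ofReal (hw0 x hx), smul_eq_mul]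

end CarriedBy

lemma nikFun_congr {μ ν : ℕ → Measure ℝ} (l d : ℕ) (h : ∀ j, l < j → μ j = ν j) :
    nikFun μ l d = nikFun ν l d := by
  induction d generalizing l with
  | zero => rfl
  | succ d ih =>
    simp only [nikFun]
    rw [ih (l + 1) fun j hj => h j (by omega), h (l + 1) (by omega)]

lemma exists_disjoint_thickening {a b c d : ℝ} (h : Disjoint (Icc a b) (Icc c d)) (hab : a ≤ b)
    (hcd : c ≤ d) : ∃ η > 0, ∀ δ ≤ η, Disjoint (Icc a b) (Icc (c - δ) (d + δ)) := by
  have h1 : b < c ∨ d < a := by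
    by_contra! hcon
    exact Set.disjoint_left.1 h (show max a c ∈ Icc a b from ⟨le_max_left _ _, max_le hab hcon.1⟩)
      ⟨le_max_right _ _, max_le hcon.2 hcd⟩
  rcases h1 with h1 | h1
  · refine ⟨(c - b) / 2, by linarith, fun δ hδ => Set.disjoint_left.2 fun x hx hx' => ?_⟩
    linarith [hx.2, hx'.1]
  · refine ⟨(a - d) / 2, by linarith, fun δ hδ => Set.disjoint_left.2 fun x hx hx' => ?_⟩
    linarith [hx.1, hx'.2]

namespace IsNikishin

variable {m : ℕ} {μ : ℕ → Measure ℝ} {a b : ℕ → ℝ}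

lemma exists_transform_zero (h : IsNikishin m μ a b) (hm : 1 ≤ m) :
    ∃ (ε : ℝ) (μ' : ℕ → Measure ℝ) (a' b' : ℕ → ℝ), 0 < ε ∧ IsNikishin m μ' a' b' ∧
      a' 0 = a 0 ∧ b' 0 = b 0 ∧ ∀ j ≤ m, ∀ g : ℝ → ℝ,
        ∫ x, g x * nikFun μ' 0 j x ∂(μ' 0) =
          ∫ x, g x * (nikFun μ 0 j x + if j = 0 then ε * nikFun μ 0 (j + 1) x else 0) ∂(μ 0) := by
  have c0 := h.carried 0 (by omega)
  have c1 := h.carried 1 (by omega)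
  obtain ⟨η, hη0, hd0, hd2⟩ : ∃ η > 0, Disjoint (Icc (a 0) (b 0)) (Icc (a 1 - η) (b 1 + η)) ∧
      (2 ≤ m → Disjoint (Icc (a 2) (b 2)) (Icc (a 1 - η) (b 1 + η))) := by
    obtain ⟨η, hη, H⟩ := exists_disjoint_thickening (h.disj 0 hm) c0.le c1.le
    by_cases h2 : 2 ≤ m
    · obtain ⟨η', hη', H'⟩ :=
        exists_disjoint_thickening (h.disj 1 h2).symm (h.carried 2 h2).le c1.le
      exact ⟨min η η', lt_min hη hη', H _ (min_le_left _ _), fun _ => H' _ (min_le_right _ _)⟩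
    · exact ⟨η, hη, H η le_rfl, fun h => absurd h h2⟩
  obtain ⟨ε, τ, hε, hτ, hw⟩ := c1.exists_perturbation hη0
  set w : ℝ → ℝ := fun x => 1 + ε * realCauchy (μ 1) (fun _ => 1) x with hwdef
  have hwpos : ∀ x ∉ Icc (a 1 - η) (b 1 + η), 0 < w x := fun x hx => (hw x hx).1
  have hsub : Icc (a 1) (b 1) ⊆ Icc (a 1 - η) (b 1 + η) :=
    Icc_subset_Icc (by linarith) (by linarith)
  have hwc : ∀ c d, Disjoint (Icc c d) (Icc (a 1 - η) (b 1 + η)) → ContinuousOn w (Icc c d) :=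
    fun c d hcd => continuousOn_const.add (continuousOn_const.mul
      (c1.continuousOn_realCauchy' continuousOn_const (hcd.mono_right hsub)))
  have hout : ∀ {c d x}, Disjoint (Icc c d) (Icc (a 1 - η) (b 1 + η)) → x ∈ Icc c d →
      x ∉ Icc (a 1 - η) (b 1 + η) := fun hcd hx => Set.disjoint_left.1 hcd hx
  let μ' : ℕ → Measure ℝ := fun j => match j with
    | 0 => (μ 0).withDensity fun x => ENNReal.ofReal (w x)
    | 1 => τ
    | 2 => (μ 2).withDensity fun x => ENNReal.ofReal (w x)
    | j + 3 => μ (j + 3)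
  let a' : ℕ → ℝ := fun j => match j with
    | 0 => a 0
    | 1 => a 1 - η
    | j + 2 => a (j + 2)
  let b' : ℕ → ℝ := fun j => match j with
    | 0 => b 0
    | 1 => b 1 + η
    | j + 2 => b (j + 2)
  have hN : IsNikishin m μ' a' b' := by
    refine ⟨fun j hj => ?_, fun j hj => ?_⟩
    · match j, hj with
      | 0, _ => exact c0.withDensity (hwc _ _ hd0) fun x hx => hwpos x (hout hd0 hx)
      | 1, _ => exact hτ
      | 2, hj =>
        exact (h.carried 2 hj).withDensity (hwc _ _ (hd2 hj)) fun x hx => hwpos x (hout (hd2 hj) hx)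
      | j + 3, hj => exact h.carried (j + 3) hj
    · match j, hj with
      | 0, _ => exact hd0
      | 1, hj => exact (hd2 hj).symm
      | j + 2, hj => exact h.disj (j + 2) hj
  refine ⟨ε, μ', a', b', hε, hN, rfl, rfl, fun j hj g => ?_⟩
  have e0 : ∫ x, g x * nikFun μ' 0 j x ∂(μ' 0) = ∫ x, w x * (g x * nikFun μ' 0 j x) ∂(μ 0) :=
    c0.integral_withDensity (hwc _ _ hd0) (fun x hx => (hwpos x (hout hd0 hx)).le) _
  rw [e0]
  refine c0.integral_congr fun x hx => ?_
  have hx' := hout hd0 hx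
  match j, hj with
  | 0, _ => simp [nikFun, hwdef]; ring
  | 1, _ =>
    have h1 : nikFun μ' 0 1 x = realCauchy τ (fun _ => 1) x := rfl
    have h2 : nikFun μ 0 1 x = realCauchy (μ 1) (fun _ => 1) x := rfl
    rw [h1, h2, ← (hw x hx').2.1]
    simp; ring
  | d + 2, hj =>
    have c2 := h.carried 2 (by omega)
    have hd2 := hd2 (by omega)
    set G := nikFun μ 2 d with hG
    have hGc : ContinuousOn G (Icc (a 2) (b 2)) := h.continuousOn_nikFun 2 d (by omega)
    have c2' : CarriedBy (μ' 2) (a 2) (b 2) := hN.carried 2 (by omega)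
    have hk : ContinuousOn (fun t => (x - t)⁻¹) (Icc (a 1 - η) (b 1 + η)) := by
      simpa using CarriedBy.continuousOn_kernel hx' continuousOn_const (g := fun _ => 1)
    have h1 : nikFun μ' 0 (d + 2) x = ∫ t, (x - t)⁻¹ * realCauchy (μ' 2) G t ∂τ := by
      rw [hG, ← nikFun_congr (μ := μ') 2 d]
      · rfl
      · intro j hj
        match j, hj with
        | j + 3, _ => rfl
    have h2 : nikFun μ 0 (d + 2) x = ∫ t, (x - t)⁻¹ * realCauchy (μ 2) G t ∂(μ 1) := rfl
    have h3 : w x * nikFun μ' 0 (d + 2) x = nikFun μ 0 (d + 2) x := by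
      rw [h1, h2, hτ.integral_mul_realCauchy c2' hk hGc hd2.symm,
        c1.integral_mul_realCauchy c2 (hk.mono hsub) hGc (h.disj 1 (by omega)), mul_neg, neg_inj,
        ← integral_const_mul]
      have e1 : ∫ t, w x * (G t * realCauchy τ (fun t => (x - t)⁻¹) t) ∂(μ' 2) =
          ∫ t, w t * (w x * (G t * realCauchy τ (fun t => (x - t)⁻¹) t)) ∂(μ 2) :=
        c2.integral_withDensity (hwc _ _ hd2) (fun x hx => (hwpos x (hout hd2 hx)).le) _
      rw [e1]
      refine c2.integral_congr fun t ht => ?_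
      rw [← (hw t (hout hd2 ht)).2.2 x hx']
      ring
    simp only [Nat.add_eq_zero_iff, OfNat.ofNat_ne_zero, and_false, if_false, add_zero]
    rw [← h3]
    ring

/-- A Nikishin system may be changed so that one of the generated measures is replaced by its sum
with a multiple of the next one. -/
lemma exists_transform : ∀ (k m : ℕ) (μ : ℕ → Measure ℝ) (a b : ℕ → ℝ), IsNikishin m μ a b →
    k + 1 ≤ m →
    ∃ (ε : ℝ) (μ' : ℕ → Measure ℝ) (a' b' : ℕ → ℝ), 0 < ε ∧ IsNikishin m μ' a' b' ∧
      a' 0 = a 0 ∧ b' 0 = b 0 ∧ ∀ j ≤ m, ∀ g : ℝ → ℝ,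
        ∫ x, g x * nikFun μ' 0 j x ∂(μ' 0) =
          ∫ x, g x * (nikFun μ 0 j x + if j = k then ε * nikFun μ 0 (j + 1) x else 0) ∂(μ 0) := by
  intro k
  induction k with
  | zero => exact fun m μ a b h hk => h.exists_transform_zero hk
  | succ k ih =>
    intro m μ a b h hk
    obtain ⟨m, rfl⟩ : ∃ m', m = m' + 1 := ⟨m - 1, by omega⟩
    obtain ⟨ε, ν, c, d, hε, hN, hc, hd, hint⟩ := ih m _ _ _ h.shift (by omega)
    let μ' : ℕ → Measure ℝ := fun j => match j with
      | 0 => μ 0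
      | j + 1 => ν j
    let a' : ℕ → ℝ := fun j => match j with
      | 0 => a 0
      | j + 1 => c j
    let b' : ℕ → ℝ := fun j => match j with
      | 0 => b 0
      | j + 1 => d j
    have hN' : IsNikishin (m + 1) μ' a' b' := by
      refine ⟨fun j hj => ?_, fun j hj => ?_⟩
      · match j, hj with
        | 0, _ => exact h.carried 0 (by omega)
        | j + 1, hj => exact hN.carried j (by omega)
      · match j, hj with
        | 0, _ =>
          show Disjoint (Icc (a 0) (b 0)) (Icc (c 0) (d 0))
          rw [hc, hd]
          exact h.disj 0 (by omega)
        | j + 1, hj => exact hN.disj j (by omega)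
    refine ⟨ε, μ', a', b', hε, hN', rfl, rfl, fun j hj g => ?_⟩
    refine (h.carried 0 (by omega)).integral_congr fun x hx => ?_
    match j, hj with
    | 0, _ => simp [nikFun]
    | j + 1, hj =>
      have hx1 : x ∉ Icc (a 1) (b 1) := Set.disjoint_left.1 (h.disj 0 (by omega)) hx
      have c1 := h.carried 1 (by omega)
      have h1 : nikFun μ' 0 (j + 1) x = ∫ t, (x - t)⁻¹ * nikFun ν 0 j t ∂(ν 0) := by
        rw [nikFun, realCauchy, ← nikFun_shift μ' 0 j]
      rw [h1, hint j (by omega)]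
      simp only [nikFun_shift, zero_add]
      have h2 : nikFun μ 0 (j + 1) x = ∫ t, (x - t)⁻¹ * nikFun μ 1 j t ∂(μ 1) := rfl
      by_cases hjk : j = k
      · subst hjk
        have h3 : nikFun μ 0 (j + 2) x = ∫ t, (x - t)⁻¹ * nikFun μ 1 (j + 1) t ∂(μ 1) := rfl
        have i1 := c1.integrable_kernel hx1 (h.continuousOn_nikFun 1 j (by omega))
        have i2 := c1.integrable_kernel hx1 (h.continuousOn_nikFun 1 (j + 1) (by omega))
        have h4 : ∫ t, (x - t)⁻¹ * (nikFun μ 1 j t + ε * nikFun μ 1 (j + 1) t) ∂(μ 1) =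
            (∫ t, (x - t)⁻¹ * nikFun μ 1 j t ∂(μ 1)) +
              ε * ∫ t, (x - t)⁻¹ * nikFun μ 1 (j + 1) t ∂(μ 1) := by
          rw [← integral_const_mul, ← integral_add i1 (i2.const_mul ε)]
          refine integral_congr_ae (ae_of_all _ fun t => ?_)
          ring
        simp only [if_true, h2, h3, h4]
      · have : ¬ (j + 1 = k + 1) := by omega
        simp only [hjk, this, if_false, add_zero, h2]

end IsNikishin

lemma IsNodes.of_transform {m n k : ℕ} {μ μ' : ℕ → Measure ℝ} {a b a' b' : ℕ → ℝ} {S : Finset ℝ}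
    {ε : ℝ} (h : IsNikishin m μ a b) (hk : k + 1 ≤ m) (ha : a' 0 = a 0) (hb : b' 0 = b 0)
    (hint : ∀ j ≤ m, ∀ g : ℝ → ℝ, ∫ x, g x * nikFun μ' 0 j x ∂(μ' 0) =
      ∫ x, g x * (nikFun μ 0 j x + if j = k then ε * nikFun μ 0 (j + 1) x else 0) ∂(μ 0))
    (hS : IsNodes m μ a b n S) : IsNodes m μ' a' b' n S := by
  refine ⟨by rw [ha, hb]; exact hS.mem, hS.card, fun j hj p hp => ?_⟩
  rw [hint j hj]
  by_cases hjk : j = k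
  · have c0 := h.carried 0 (by omega)
    have hc : ContinuousOn (fun t => p.eval t * (Lagrange.nodal S id).eval t)
        (Icc (a 0) (b 0)) := by fun_prop
    have hI : ∀ l ≤ m, Integrable (fun t => p.eval t * (Lagrange.nodal S id).eval t *
        nikFun μ 0 l t) (μ 0) := fun l hl =>
      c0.integrable (hc.mul (h.continuousOn_nikFun 0 l (by omega)))
    simp only [hjk, if_true, mul_add, mul_left_comm _ ε]
    subst hjk
    rw [integral_add (hI j hj) ((hI (j + 1) hk).const_mul ε), integral_const_mul, hS.orth j hj p hp,
      hS.orth (j + 1) hk p ?_]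
    · simp
    · refine hp.trans_le ?_
      rw [if_neg (Nat.succ_ne_zero j)]
      exact_mod_cast (by split_ifs <;> omega : (if j = 0 then n else n + 1) ≤ n + 1)
  · simpa [hjk] using hS.orth j hj p hp

lemma IsNikishin.exists_sum_abs_quadWeight_le : ∀ (k m : ℕ) (μ : ℕ → Measure ℝ) (a b : ℕ → ℝ),
    IsNikishin m μ a b → k ≤ m →
    ∃ B : ℝ, ∀ n S, IsNodes m μ a b n S → ∑ i ∈ S, |quadWeight μ S k i| ≤ B := by
  intro k
  induction k with
  | zero => exact fun m μ a b h _ => ⟨(μ 0).real univ, fun n S hS => hS.sum_abs_quadWeight_zero_le h⟩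
  | succ k ih =>
    intro m μ a b h hk
    obtain ⟨ε, μ', a', b', hε, hN, ha, hb, hint⟩ := exists_transform k m μ a b h hk
    obtain ⟨B, hB⟩ := ih m μ a b h (by omega)
    obtain ⟨B', hB'⟩ := ih m μ' a' b' hN (by omega)
    refine ⟨(B' + B) / ε, fun n S hS => ?_⟩
    have hw : ∀ i, quadWeight μ' S k i = quadWeight μ S k i + ε * quadWeight μ S (k + 1) i := by
      intro i
      have c0 := h.carried 0 (by omega)
      have i1 := c0.integrable_polynomial_mul (h.continuousOn_nikFun 0 k (by omega))
        (Lagrange.basis S id i)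
      have i2 := c0.integrable_polynomial_mul (h.continuousOn_nikFun 0 (k + 1) (by omega))
        (Lagrange.basis S id i)
      simp only [quadWeight]
      rw [hint k (by omega), ← integral_const_mul, ← integral_add i1 (i2.const_mul ε)]
      refine integral_congr_ae (ae_of_all _ fun t => ?_)
      simp only [if_true]
      ring
    rw [le_div_iff₀ hε, Finset.sum_mul]
    calc ∑ i ∈ S, |quadWeight μ S (k + 1) i| * ε
        ≤ ∑ i ∈ S, (|quadWeight μ' S k i| + |quadWeight μ S k i|) := by
          refine Finset.sum_le_sum fun i _ => ?_
          have : |quadWeight μ S (k + 1) i| * ε = |quadWeight μ' S k i - quadWeight μ S k i| := by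
            rw [hw, add_sub_cancel_left, abs_mul, abs_of_pos hε, mul_comm]
          rw [this]
          exact abs_sub _ _
      _ ≤ B' + B := by
          rw [Finset.sum_add_distrib]
          exact add_le_add (hB' n S (hS.of_transform h hk ha hb hint)) (hB n S hS)

/-- The interpolatory quadrature formula is exact. -/
lemma sum_quadWeight_mul_eval {m : ℕ} {μ : ℕ → Measure ℝ} {a b : ℕ → ℝ} (h : IsNikishin m μ a b)
    (S : Finset ℝ) {k : ℕ} (hk : k ≤ m) {p : ℝ[X]} (hp : p.degree < S.card) :
    ∑ i ∈ S, quadWeight μ S k i * p.eval i = ∫ t, p.eval t * nikFun μ 0 k t ∂(μ 0) := by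
  have c0 := h.carried 0 (by omega)
  have hI := fun q : ℝ[X] =>
    c0.integrable_polynomial_mul (h.continuousOn_nikFun 0 k (by omega)) q
  have e : ∀ t, p.eval t = ∑ i ∈ S, p.eval i * (Lagrange.basis S id i).eval t := by
    intro t
    conv_lhs => rw [Lagrange.eq_interpolate (s := S) (v := id) (Function.injective_id.injOn) hp]
    simp [Lagrange.interpolate_apply, eval_finsetSum]
  have e' : ∀ t, p.eval t * nikFun μ 0 k t =
      ∑ i ∈ S, p.eval i * ((Lagrange.basis S id i).eval t * nikFun μ 0 k t) := by
    intro t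
    rw [e, Finset.sum_mul]
    exact Finset.sum_congr rfl fun i _ => mul_assoc _ _ _
  simp only [e']
  rw [integral_finsetSum S fun i _ => (hI (Lagrange.basis S id i)).const_mul (p.eval i)]
  refine Finset.sum_congr rfl fun i hi => ?_
  rw [integral_const_mul, quadWeight, mul_comm]

lemma IsNikishin.tendsto_sum_quadWeight {m : ℕ} {μ : ℕ → Measure ℝ} {a b : ℕ → ℝ}
    (h : IsNikishin m μ a b) {S : ℕ → Finset ℝ} (hS : ∀ n, IsNodes m μ a b n (S n)) {k : ℕ}
    (hk : k ≤ m) {f : ℝ → ℝ} (hf : ContinuousOn f (Icc (a 0) (b 0))) :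
    Tendsto (fun n => ∑ i ∈ S n, quadWeight μ (S n) k i * f i) atTop
      (nhds (∫ t, f t * nikFun μ 0 k t ∂(μ 0))) := by
  obtain ⟨B, hB⟩ := h.exists_sum_abs_quadWeight_le k m μ a b hk
  have c0 := h.carried 0 (by omega)
  have hG := h.continuousOn_nikFun 0 k (by omega)
  set G := nikFun μ 0 k
  have hB0 : 0 ≤ B := (Finset.sum_nonneg fun _ _ => abs_nonneg _).trans (hB 0 _ (hS 0))
  set A := ∫ t, |G t| ∂(μ 0) with hA
  have hA0 : 0 ≤ A := integral_nonneg fun _ => abs_nonneg _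
  rw [Metric.tendsto_atTop]
  intro δ hδ
  have hη : 0 < δ / (2 * (A + B + 1)) := by positivity
  obtain ⟨p, hp⟩ := exists_polynomial_near_of_continuousOn (a 0) (b 0) f hf _ hη
  set η := δ / (2 * (A + B + 1)) with hηdef
  refine ⟨p.natDegree + 1, fun n hn => ?_⟩
  have hdeg : p.degree < ((S n).card : ℕ) := by
    rw [(hS n).card]
    refine p.degree_le_natDegree.trans_lt ?_
    exact_mod_cast (by omega : p.natDegree < n + m * (n + 1))
  have e1 := sum_quadWeight_mul_eval h (S n) hk hdeg
  have hIf : Integrable (fun t => f t * G t) (μ 0) := c0.integrable (hf.mul hG)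
  have hIp := c0.integrable_polynomial_mul hG p
  have b1 : |∑ i ∈ S n, quadWeight μ (S n) k i * f i -
      ∑ i ∈ S n, quadWeight μ (S n) k i * p.eval i| ≤ η * B := by
    rw [← Finset.sum_sub_distrib]
    refine (Finset.abs_sum_le_sum_abs _ _).trans ?_
    calc _ ≤ ∑ i ∈ S n, η * |quadWeight μ (S n) k i| := by
          refine Finset.sum_le_sum fun i hi => ?_
          rw [← mul_sub, abs_mul, mul_comm]
          refine mul_le_mul_of_nonneg_right ?_ (abs_nonneg _)
          rw [abs_sub_comm]
          exact (hp i ((hS n).mem i hi)).le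
      _ ≤ η * B := by
          rw [← Finset.mul_sum]
          exact mul_le_mul_of_nonneg_left (hB n _ (hS n)) hη.le
  have b2 : |(∫ t, p.eval t * G t ∂(μ 0)) - ∫ t, f t * G t ∂(μ 0)| ≤ η * A := by
    rw [← integral_sub hIp hIf, hA, ← integral_const_mul, ← Real.norm_eq_abs]
    refine norm_integral_le_of_norm_le ((c0.integrable hG).abs.const_mul _)
      (c0.ae_mem.mono fun t ht => ?_)
    rw [← sub_mul, norm_mul]
    exact mul_le_mul_of_nonneg_right (hp t ht).le (abs_nonneg _)
  rw [Real.dist_eq]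
  calc _ = |(∑ i ∈ S n, quadWeight μ (S n) k i * f i -
        ∑ i ∈ S n, quadWeight μ (S n) k i * p.eval i) +
        ((∫ t, p.eval t * G t ∂(μ 0)) - ∫ t, f t * G t ∂(μ 0))| := by
        rw [e1]; congr 1; ring
    _ ≤ η * B + η * A := (abs_add_le _ _).trans (add_le_add b1 b2)
    _ < δ := by
        have : η * (2 * (A + B + 1)) = δ := div_mul_cancel₀ _ (by positivity)
        nlinarith

lemma CarriedBy.typeII_relations {μ : Measure ℝ} {a b : ℝ} {G : ℝ → ℝ} (h : CarriedBy μ a b)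
    (hG : ContinuousOn G (Icc a b)) {Q P : ℝ[X]} {d : ℕ}
    (hO : ∃ K R : ℝ, ∀ x : ℝ, R ≤ x → b < x →
      |Q.eval x * realCauchy μ G x - P.eval x| ≤ K / x ^ (d + 1)) :
    (∀ p : ℝ[X], p.degree < (d : ℕ) → ∫ t, p.eval t * (Q.eval t * G t) ∂μ = 0) ∧
      ∀ (x : ℝ) (E : ℝ[X]), Q = C (Q.eval x) + (X - C x) * E →
        P.eval x = ∫ t, E.eval t * G t ∂μ := by
  have hI := h.integrable_polynomial_mul hG
  obtain ⟨D, E, hDE⟩ := exists_polynomial_dividedDifference hI Q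
  have hQG : ContinuousOn (fun t => Q.eval t * G t) (Icc a b) := Q.continuous.continuousOn.mul hG
  obtain ⟨K, R, hK⟩ := hO
  obtain ⟨h1, h2⟩ := h.moments_eq_zero d (D - P) _ hQG ⟨K, by
    filter_upwards [eventually_ge_atTop R, eventually_gt_atTop b] with x hxR hxb
    have hx : x ∉ Icc a b := fun hx => absurd hx.2 (not_le.2 hxb)
    have e := mul_realCauchy_eq hI (hDE x).1 (h.ae_ne hx) (h.integrable_kernel hx hG)
    have := hK x hxR hxb
    rw [e, ← (hDE x).2] at this
    rw [eval_sub]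
    convert this using 2
    ring⟩
  refine ⟨fun p hp => h.integral_polynomial_mul_eq_zero hQG h2 hp, fun x F hF => ?_⟩
  have hEF : F = E x := by
    have := hF.symm.trans (hDE x).1
    exact mul_left_cancel₀ (X_sub_C_ne_zero x) (add_left_cancel this)
  rw [hEF, ← (hDE x).2, sub_eq_zero.1 h1]

lemma CarriedBy.integral_withDensity_sub {μ : Measure ℝ} {a b : ℝ} (h : CarriedBy μ a b)
    {f g w : ℝ → ℝ} (hf : ContinuousOn f (Icc a b)) (hw : ContinuousOn w (Icc a b))
    (hgw : ∀ x ∈ Icc a b, g x = w x) :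
    (∫ x, f x ∂(μ.withDensity fun x => ENNReal.ofReal (g x))) -
      ∫ x, f x ∂(μ.withDensity fun x => ENNReal.ofReal (-g x)) = ∫ x, f x * w x ∂μ := by
  have key : ∀ u v : ℝ → ℝ, ContinuousOn v (Icc a b) → (∀ x ∈ Icc a b, u x = v x) →
      ∫ x, f x ∂(μ.withDensity fun x => ENNReal.ofReal (u x)) = ∫ x, max (v x) 0 * f x ∂μ := by
    intro u v hv huv
    have : (fun x => ENNReal.ofReal (u x)) =ᵐ[μ] fun x => ENNReal.ofReal (v x) :=
      h.ae_mem.mono fun x hx => by simp only [huv x hx]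
    rw [withDensity_congr_ae this, integral_withDensity_eq_integral_toReal_smul₀
      (h.aemeasurable_ofReal hv) (ae_of_all _ fun _ => ENNReal.ofReal_lt_top)]
    simp only [ENNReal.toReal_ofReal', smul_eq_mul]
  have i1 : Integrable (fun x => max (w x) 0 * f x) μ :=
    h.integrable ((hw.sup continuousOn_const).mul hf)
  have i2 : Integrable (fun x => max (-w x) 0 * f x) μ :=
    h.integrable ((hw.neg.sup continuousOn_const).mul hf)
  rw [key g w hw hgw, key (fun x => -g x) (fun x => -w x) hw.neg fun x hx => by rw [hgw x hx],
    ← integral_sub i1 i2]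
  refine integral_congr_ae (ae_of_all _ fun x => ?_)
  rcases le_total 0 (w x) with h0 | h0
  · simp [h0, mul_comm]
  · simp [h0, mul_comm]

namespace SignedM

/-- The total variation of a signed measure of constant sign. -/
def absMeasure (s : SignedM) : Measure ℝ := s.pos + s.neg

lemma exists_sign_rintegral {s : SignedM} (hs : s.pos = 0 ∨ s.neg = 0) :
    ∃ c : ℝ, c ≠ 0 ∧ ∀ f, s.rintegral f = c * ∫ x, f x ∂s.absMeasure := by
  rcases hs with hs | hs
  · exact ⟨-1, by norm_num, fun f => by simp [rintegral, absMeasure, hs]⟩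
  · exact ⟨1, one_ne_zero, fun f => by simp [rintegral, absMeasure, hs]⟩

lemma exists_sign_rintegral_withDensityR {s : SignedM} {a b : ℝ} (hs : s.pos = 0 ∨ s.neg = 0)
    (h : CarriedBy s.absMeasure a b) :
    ∃ c : ℝ, c ≠ 0 ∧ ∀ f g w : ℝ → ℝ, ContinuousOn f (Icc a b) → ContinuousOn w (Icc a b) →
      (∀ x ∈ Icc a b, g x = w x) →
      (s.withDensityR g).rintegral f = c * ∫ x, f x * w x ∂s.absMeasure := by
  rcases hs with hs | hs
  · refine ⟨-1, by norm_num, fun f g w hf hw hgw => ?_⟩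
    rw [← h.integral_withDensity_sub hf hw hgw]
    simp [rintegral, absMeasure, withDensityR, hs]
  · refine ⟨1, one_ne_zero, fun f g w hf hw hgw => ?_⟩
    rw [← h.integral_withDensity_sub hf hw hgw]
    simp [rintegral, absMeasure, withDensityR, hs]

lemma cauchy_ofReal (s : SignedM) (x : ℝ) : s.cauchy x = (s.cauchyR x : ℂ) := by
  have : ∀ t : ℝ, ((x : ℂ) - (t : ℂ))⁻¹ = (((x - t)⁻¹ : ℝ) : ℂ) := fun t => by push_cast; rfl
  simp only [cauchy, cintegral, cauchyR, rintegral, this]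
  rw [Complex.ofReal_sub, ← integral_complex_ofReal, ← integral_complex_ofReal]

lemma measure_compl_msupport (μ : Measure ℝ) : μ (msupport μ)ᶜ = 0 := by
  refine measure_null_of_locally_null _ fun x hx => ?_
  obtain ⟨U, hU, hxU, h0⟩ : ∃ U : Set ℝ, IsOpen U ∧ x ∈ U ∧ μ U = 0 := by
    simpa [msupport] using hx
  exact ⟨U, mem_nhdsWithin_of_mem_nhds (hU.mem_nhds hxU), h0⟩

lemma msupport_zero : msupport 0 = ∅ := by
  ext x
  simp only [msupport, mem_ofPred_eq, mem_empty_iff_false, iff_false]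
  exact fun h => h univ isOpen_univ (mem_univ _) rfl

lemma supp_eq_msupport {s : SignedM} (hs : s.pos = 0 ∨ s.neg = 0) :
    s.supp = msupport s.absMeasure := by
  rcases hs with hs | hs <;> simp [supp, absMeasure, hs, msupport_zero]

lemma msupport_subset {μ : Measure ℝ} {F : Set ℝ} (hF : IsClosed F) (h : μ Fᶜ = 0) :
    msupport μ ⊆ F := by
  intro x hx
  by_contra hxF
  exact hx Fᶜ hF.isOpen_compl hxF h

end SignedM

lemma IsM.carriedBy {s : SignedM} {Δ : Set ℝ} (h : IsM s Δ) :
    CarriedBy s.absMeasure (sInf s.supp) (sSup s.supp) where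
  finite := by
    have := h.posFinite
    have := h.negFinite
    unfold SignedM.absMeasure
    infer_instance
  compl_null := by
    refine measure_mono_null (compl_subset_compl.2 ?_)
      (SignedM.measure_compl_msupport s.absMeasure)
    rw [← SignedM.supp_eq_msupport h.constSign]
    exact fun x hx => ⟨csInf_le h.compactSupp.bddBelow hx, le_csSup h.compactSupp.bddAbove hx⟩
  compl_finite_ne := fun F hF h0 => by
    refine h.infiniteSupp (hF.subset ?_)
    rw [SignedM.supp_eq_msupport h.constSign]
    exact SignedM.msupport_subset hF.isClosed h0

lemma exists_rintegral_nikSys {m : ℕ} {σ : ℕ → SignedM} {a b : ℕ → ℝ}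
    (hs : ∀ j ≤ m, (σ j).pos = 0 ∨ (σ j).neg = 0)
    (h : IsNikishin m (fun j => (σ j).absMeasure) a b) (d : ℕ) : ∀ l, l + d ≤ m →
    ∃ c : ℝ, c ≠ 0 ∧ ∀ f, ContinuousOn f (Icc (a l) (b l)) →
      (nikSys σ l (l + d)).rintegral f =
        c * ∫ t, f t * nikFun (fun j => (σ j).absMeasure) l d t ∂(σ l).absMeasure := by
  induction d with
  | zero =>
    intro l hl
    obtain ⟨c, hc, H⟩ := SignedM.exists_sign_rintegral (hs l hl)
    refine ⟨c, hc, fun f _ => ?_⟩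
    rw [nikSys]
    simp [H, nikFun]
  | succ d ih =>
    intro l hl
    obtain ⟨c, hc, H⟩ := ih (l + 1) (by omega)
    obtain ⟨c', hc', H'⟩ := SignedM.exists_sign_rintegral_withDensityR (hs l (by omega))
      (h.carried l (by omega))
    refine ⟨c' * c, mul_ne_zero hc' hc, fun f hf => ?_⟩
    have e : nikSys σ l (l + (d + 1)) = (σ l).nik (nikSys σ (l + 1) (l + 1 + d)) := by
      rw [nikSys, dif_pos (by omega), show l + (d + 1) = l + 1 + d by omega]
    have hcont := h.continuousOn_nikFun l (d + 1) (by omega)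
    rw [e, SignedM.nik, H' f _ (fun x => c * nikFun (fun j => (σ j).absMeasure) l (d + 1) x) hf
      (continuousOn_const.mul hcont)]
    · simp only [mul_left_comm _ c, integral_const_mul]
      ring
    · intro x hx
      have hx1 : x ∉ Icc (a (l + 1)) (b (l + 1)) := Set.disjoint_left.1 (h.disj l (by omega)) hx
      rw [SignedM.cauchyR, H]
      · rfl
      · simpa using CarriedBy.continuousOn_kernel hx1 (continuousOn_const (c := (1 : ℝ)))

lemma exists_eq_C_mul_nodal {Q : ℝ[X]} (hQ : Q ≠ 0) {S : Finset ℝ} (hdeg : Q.degree ≤ (S.card : ℕ))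
    (h0 : ∀ i ∈ S, Q.eval i = 0) : ∃ r : ℝ, r ≠ 0 ∧ Q = C r * Lagrange.nodal S id := by
  have hdvd : Lagrange.nodal S id ∣ Q := by
    refine Finset.prod_dvd_of_coprime (fun i _ j _ hij => ?_) fun i hi => ?_
    · exact pairwise_coprime_X_sub_C Function.injective_id hij
    · exact dvd_iff_isRoot.2 (h0 i hi)
  obtain ⟨R, rfl⟩ := hdvd
  have hR : R ≠ 0 := right_ne_zero_of_mul hQ
  have hR0 : R.natDegree = 0 := by
    have := natDegree_le_iff_degree_le.2 hdeg
    rw [natDegree_mul (left_ne_zero_of_mul hQ) hR, Lagrange.natDegree_nodal] at this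
    omega
  obtain ⟨r, rfl⟩ := natDegree_eq_zero.1 hR0
  exact ⟨r, by simpa using hR, mul_comm _ _⟩

/-- The divided difference of a polynomial at one of its simple zeros is a multiple of the
Lagrange basis polynomial. -/
lemma eval_divX_eq {Q E : ℝ[X]} {S : Finset ℝ} {r i : ℝ} (hQ : Q = C r * Lagrange.nodal S id)
    (hi : i ∈ S) (hE : Q = C (Q.eval i) + (X - C i) * E) (t : ℝ) :
    E.eval t = (derivative Q).eval i * (Lagrange.basis S id i).eval t := by
  have hQi : Q.eval i = 0 := by
    have : (Lagrange.nodal S id).eval i = 0 := Lagrange.eval_nodal_at_node (v := id) hi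
    rw [hQ, eval_mul, this, mul_zero]
  rw [hQi, C_0, zero_add] at hE
  have hw : Lagrange.nodalWeight S id i ≠ 0 :=
    Lagrange.nodalWeight_ne_zero (Function.injective_id.injOn) hi
  have hP : C (Lagrange.nodalWeight S id i) * E = C r * Lagrange.basis S id i := by
    refine mul_left_cancel₀ (X_sub_C_ne_zero i) ?_
    rw [mul_left_comm, ← hE, hQ]
    refine Polynomial.funext fun u => ?_
    have := IsNodes.mul_eval_basis hi u
    simp only [eval_mul, eval_C, eval_sub, eval_X]
    linear_combination -r * this
  have hev := fun u => congrArg (eval u) hP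
  simp only [eval_mul, eval_C] at hev
  have hb : (Lagrange.basis S id i).eval i = 1 :=
    Lagrange.eval_basis_self (v := id) (Function.injective_id.injOn) hi
  have hd : (derivative Q).eval i = E.eval i := by
    rw [hE]
    simp
  have h1 := hev i
  rw [hb, mul_one] at h1
  rw [hd]
  refine mul_left_cancel₀ hw ?_
  rw [hev t, ← mul_assoc, h1]

/-- A type II polynomial with real zeros provides the nodes and, up to a factor, the weights of the
interpolatory quadrature formulas. -/
lemma IsTypeII.quadrature {m n : ℕ} {σ : ℕ → SignedM} {a b : ℕ → ℝ} {Q : ℝ[X]} {P : ℕ → ℝ[X]}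
    {c : ℕ → ℝ} {S : Finset ℝ} (h : IsNikishin m (fun j => (σ j).absMeasure) a b)
    (hc0 : ∀ k ≤ m, c k ≠ 0)
    (hc : ∀ k ≤ m, ∀ f, ContinuousOn f (Icc (a 0) (b 0)) → (nikSys σ 0 k).rintegral f =
      c k * ∫ t, f t * nikFun (fun j => (σ j).absMeasure) 0 k t ∂(σ 0).absMeasure)
    (hQ : IsTypeII σ m (fun j => if j = 0 then n else n + 1) Q P)
    (hS : S.card = n + m * (n + 1)) (hmem : ∀ i ∈ S, i ∈ Icc (a 0) (b 0))
    (hzero : ∀ i ∈ S, Q.eval i = 0) (hsimple : ∀ i ∈ S, (derivative Q).eval i ≠ 0) :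
    IsNodes m (fun j => (σ j).absMeasure) a b n S ∧ ∀ k ≤ m, ∀ i ∈ S,
      (P k).eval i / (derivative Q).eval i =
        c k * quadWeight (fun j => (σ j).absMeasure) S k i := by
  obtain ⟨hQ0, hdeg, hO⟩ := hQ
  set μ : ℕ → Measure ℝ := fun j => (σ j).absMeasure with hμ
  have c0 : CarriedBy (μ 0) (a 0) (b 0) := h.carried 0 (Nat.zero_le _)
  have hcard : (∑ j ∈ Finset.range (m + 1), if j = 0 then n else n + 1) = S.card := by
    rw [hS, Finset.sum_range_succ']
    simp [add_comm]
  obtain ⟨r, hr, hQr⟩ := exists_eq_C_mul_nodal hQ0 (by rwa [hcard] at hdeg) hzero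
  have hrel : ∀ k ≤ m, (∀ p : ℝ[X], p.degree < (if k = 0 then n else n + 1 : ℕ) →
      ∫ t, p.eval t * (Q.eval t * (c k * nikFun μ 0 k t)) ∂(μ 0) = 0) ∧
      ∀ (x : ℝ) (E : ℝ[X]), Q = C (Q.eval x) + (X - C x) * E →
        (P k).eval x = ∫ t, E.eval t * (c k * nikFun μ 0 k t) ∂(μ 0) := by
    intro k hk
    refine c0.typeII_relations
      (continuousOn_const.mul (h.continuousOn_nikFun 0 k (by omega))) ?_
    obtain ⟨K, R, hK⟩ := hO k hk
    refine ⟨K, max R 0, fun x hxR hxb => ?_⟩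
    have hx0 : 0 ≤ x := (le_max_right _ _).trans hxR
    have hx : x ∉ Icc (a 0) (b 0) := fun hx => absurd hx.2 (not_le.2 hxb)
    have hn : ‖(x : ℂ)‖ = x := by rw [Complex.norm_real, Real.norm_of_nonneg hx0]
    have e1 : (nikSys σ 0 k).cauchyR x = realCauchy (μ 0) (fun t => c k * nikFun μ 0 k t) x := by
      rw [SignedM.cauchyR, hc k hk _
        (by simpa using CarriedBy.continuousOn_kernel hx (continuousOn_const (c := (1 : ℝ))))]
      simp only [realCauchy, mul_left_comm _ (c k), integral_const_mul]
      rfl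
    have e2 : ∀ q : ℝ[X], aeval (x : ℂ) q = ((q.eval x : ℝ) : ℂ) := fun q => by
      simpa using aeval_algebraMap_apply ℂ x q
    have := hK x (by rw [hn]; exact (le_max_left _ _).trans hxR)
    rw [SignedM.cauchy_ofReal, e1, e2, e2, hn, ← Complex.ofReal_mul, ← Complex.ofReal_sub,
      Complex.norm_real] at this
    exact this
  refine ⟨⟨hmem, hS, fun j hj p hp => ?_⟩, fun k hk i hi => ?_⟩
  · have := (hrel j hj).1 p hp
    have e : ∀ t, p.eval t * (Q.eval t * (c j * nikFun μ 0 j t)) =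
        (r * c j) * (p.eval t * (Lagrange.nodal S id).eval t * nikFun μ 0 j t) := by
      intro t
      rw [hQr, eval_mul, eval_C]
      ring
    simp only [e, integral_const_mul] at this
    exact (mul_eq_zero.1 this).resolve_left (mul_ne_zero hr (hc0 j hj))
  · obtain ⟨_, E, hE⟩ := exists_polynomial_dividedDifference
      (c0.integrable_polynomial_mul (continuousOn_const (c := (1 : ℝ)))) Q
    have hEi := (hE i).1
    rw [div_eq_iff (hsimple i hi), (hrel k hk).2 i _ hEi, quadWeight, mul_right_comm,
      ← integral_const_mul]
    refine integral_congr_ae (ae_of_all _ fun t => ?_)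
    simp only [eval_divX_eq hQr hi hEi t]
    ring

/-- Corollary 2, third part (convergence of the simultaneous quadrature rules): along the
multi-indices `(n, n+1, …, n+1)`, for every `k ≤ m` and every continuous function `f` on
`Co(supp σ₀)` one has `Σ_i λ_{n,k,i} f(x_{n,i}) → ∫ f ds_{0,k}` as `n → ∞`. -/
theorem stmt13
    (m : ℕ)
    (σ : ℕ → SignedM) (Δ : ℕ → Set ℝ)
    (hσ : ∀ j ≤ m, IsM (σ j) (Δ j))
    (hdisj : ∀ j, j + 1 ≤ m → Δ j ∩ Δ (j + 1) = ∅)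
    (Nn : ℕ → ℕ)
    (hNn : ∀ n, Nn n = ∑ j ∈ Finset.range (m + 1), if j = 0 then n else n + 1)
    (Q : ℕ → Polynomial ℝ) (P : ℕ → ℕ → Polynomial ℝ)
    (hQP : ∀ n : ℕ, IsTypeII σ m (fun j => if j = 0 then n else n + 1) (Q n) (P n))
    (x : (n : ℕ) → Fin (Nn n) → ℝ)
    (hx : ∀ n, StrictMono (x n))
    (hxint : ∀ n i, x n i ∈ interior (Δ 0))
    (hxzero : ∀ n i, Polynomial.eval (x n i) (Q n) = 0)
    (hxsimple : ∀ n i, Polynomial.eval (x n i) (Polynomial.derivative (Q n)) ≠ 0)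
    (hxall : ∀ n, ∀ z : ℂ, aeval z (Q n) = 0 → ∃ i, ((x n i : ℝ) : ℂ) = z) :
    ∀ k ≤ m, ∀ f : ℝ → ℝ, ContinuousOn f (Δ 0) →
      Filter.Tendsto
        (fun n : ℕ => ∑ i : Fin (Nn n),
          (Polynomial.eval (x n i) (P n k) /
              Polynomial.eval (x n i) (Polynomial.derivative (Q n))) * f (x n i))
        Filter.atTop (nhds ((nikSys σ 0 k).rintegral f)) := by
  intro k hk f hf
  set μ : ℕ → Measure ℝ := fun j => (σ j).absMeasure with hμ
  set a : ℕ → ℝ := fun j => sInf (σ j).supp with ha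
  set b : ℕ → ℝ := fun j => sSup (σ j).supp with hb
  have hΔ : ∀ j ≤ m, Δ j = Icc (a j) (b j) := fun j hj => (hσ j hj).hullEq
  have h : IsNikishin m μ a b := by
    refine ⟨fun j hj => (hσ j hj).carriedBy, fun j hj => ?_⟩
    rw [← hΔ j (by omega), ← hΔ (j + 1) hj]
    exact Set.disjoint_iff_inter_eq_empty.2 (hdisj j hj)
  have hex : ∀ k, ∃ c : ℝ, k ≤ m → c ≠ 0 ∧ ∀ f, ContinuousOn f (Icc (a 0) (b 0)) →
      (nikSys σ 0 k).rintegral f = c * ∫ t, f t * nikFun μ 0 k t ∂(σ 0).absMeasure := by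
    intro k
    by_cases hk : k ≤ m
    · obtain ⟨c, hc⟩ := exists_rintegral_nikSys (fun j hj => (hσ j hj).constSign) h k 0 (by omega)
      rw [zero_add] at hc
      exact ⟨c, fun _ => hc⟩
    · exact ⟨0, fun h => absurd h hk⟩
  choose c hc using hex
  have hinj : ∀ n, Function.Injective (x n) := fun n => (hx n).injective
  let S : ℕ → Finset ℝ := fun n => Finset.univ.image (x n)
  have hquad := fun n => IsTypeII.quadrature (S := S n) h (fun k hk => (hc k hk).1)
    (fun k hk => (hc k hk).2) (hQP n)
    (by
      rw [Finset.card_image_of_injective _ (hinj n), Finset.card_univ, Fintype.card_fin, hNn,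
        Finset.sum_range_succ']
      simp [add_comm])
    (by
      intro i hi
      obtain ⟨j, -, rfl⟩ := Finset.mem_image.1 hi
      rw [← hΔ 0 (Nat.zero_le _)]
      exact interior_subset (hxint n j))
    (by
      intro i hi
      obtain ⟨j, -, rfl⟩ := Finset.mem_image.1 hi
      exact hxzero n j)
    (by
      intro i hi
      obtain ⟨j, -, rfl⟩ := Finset.mem_image.1 hi
      exact hxsimple n j)
  rw [hΔ 0 (Nat.zero_le _)] at hf
  rw [(hc k hk).2 f hf]
  refine ((h.tendsto_sum_quadWeight (fun n => (hquad n).1) hk hf).const_mul (c k)).congr fun n => ?_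
  rw [Finset.mul_sum, Finset.sum_image fun i _ j _ hij => hinj n hij]
  refine Finset.sum_congr rfl fun i _ => ?_
  rw [(hquad n).2 k hk (x n i) (Finset.mem_image_of_mem _ (Finset.mem_univ i)), mul_assoc]
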